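/- arXiv:2409.04024 — 2 statements merged into one kernel-verified Lean document; each statement's English description precedes it below -/
import Mathlib

section
/- Let a1 ≥ 0, δ > 0 and a2 ≤ −1. Then system (II) has a nonconstant periodic solution, and any two nonconstant periodic solutions of (II) have the same image (range) in ℝ × ℝ. (That is, system (II) has exactly one limit cycle when a2 ≤ −1.) -/
/-- A solution of system (II): x' = y, y' = −x(a1 + x²)(x² − 1) − δ(a2 + x²) y. -/
def IsSolII (a1 a2 δ : ℝ) (γ : ℝ → ℝ × ℝ) : Prop :=
  ∀ t : ℝ, HasDerivAt γ
    ((γ t).2,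
      -((γ t).1 * (a1 + (γ t).1 ^ 2) * ((γ t).1 ^ 2 - 1))
        - δ * (a2 + (γ t).1 ^ 2) * (γ t).2) t

/-- A nonconstant periodic solution of system (II). -/
def IsNonconstPeriodicSolII (a1 a2 δ : ℝ) (γ : ℝ → ℝ × ℝ) : Prop :=
  IsSolII a1 a2 δ γ ∧ (∃ T : ℝ, 0 < T ∧ ∀ t : ℝ, γ (t + T) = γ t) ∧
    ¬ (∀ t s : ℝ, γ t = γ s)

open Set Filter Topology

/-- Parameters of system (II), with `B = -a2`. -/
structure Params where
  a : ℝ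
  δ : ℝ
  B : ℝ
  ha : 0 ≤ a
  hδ : 0 < δ
  hB : 1 ≤ B

noncomputable section

namespace Params

variable (p : Params)

/-- The restoring force. -/
def g (x : ℝ) : ℝ := x * (p.a + x ^ 2) * (x ^ 2 - 1)

/-- The damping coefficient. -/
def f (x : ℝ) : ℝ := p.δ * (x ^ 2 - p.B)

/-- The primitive of the damping coefficient. -/
def F (x : ℝ) : ℝ := p.δ * (x ^ 3 / 3 - p.B * x)

/-- The potential. -/
def G (x : ℝ) : ℝ := x ^ 6 / 6 + (p.a - 1) * x ^ 4 / 4 - p.a * x ^ 2 / 2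

/-- The level used in the Dulac–Cherkas function. -/
def c : ℝ := p.B ^ 2 * (p.a - 1 + 4 * p.B) / 6

/-- The Dulac–Cherkas function. -/
def Psi (x y : ℝ) : ℝ := y ^ 2 + p.F x * y + (2 * p.G x - p.c)

/-- The value of `Psi' + f * Psi` along trajectories. -/
def Phi (x : ℝ) : ℝ :=
  p.δ / 6 * ((p.a - 1 + 4 * p.B) * (x ^ 2 - p.B) ^ 2 * (x ^ 2 + p.B)
    + 4 * (p.B - 1) * (p.B + p.a) * (x ^ 2) ^ 2)

/-- The discriminant of `Psi` as a polynomial in `y`. -/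
def disc (x : ℝ) : ℝ := p.F x ^ 2 - 4 * (2 * p.G x - p.c)

lemma lead_pos : 0 < p.a - 1 + 4 * p.B := by linarith [p.ha, p.hB]

lemma c_pos : 0 < p.c := by
  have := p.lead_pos
  have := p.hB
  unfold c; positivity

lemma Phi_eq (x : ℝ) : p.f x * (2 * p.G x - p.c) - p.g x * p.F x = p.Phi x := by
  unfold f G c g F Phi; ring

lemma Phi_nonneg (x : ℝ) : 0 ≤ p.Phi x := by
  have h1 := p.lead_pos
  have h2 := p.hB
  have h3 := p.hδ
  have h4 := p.ha
  have : 0 ≤ p.B - 1 := by linarith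
  unfold Phi; positivity

lemma Phi_pos {x : ℝ} (hx : x ^ 2 ≠ p.B) : 0 < p.Phi x := by
  have h1 := p.lead_pos
  have h2 := p.hB
  have h3 := p.hδ
  have h4 := p.ha
  have : 0 ≤ p.B - 1 := by linarith
  have : 0 < (x ^ 2 - p.B) ^ 2 := by
    have : x ^ 2 - p.B ≠ 0 := sub_ne_zero.mpr hx
    positivity
  unfold Phi; positivity

lemma sq_eq_one_of_Phi_eq_zero {x : ℝ} (h : p.Phi x = 0) : x ^ 2 = 1 := by
  by_contra hne
  by_cases hx : x ^ 2 = p.B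
  · have h2 : 1 < p.B := lt_of_le_of_ne p.hB (by rw [← hx]; exact fun h => hne h.symm)
    have h3 := p.hδ
    have h4 := p.ha
    have : 0 < p.B - 1 := by linarith
    have : 0 < p.Phi x := by unfold Phi; rw [hx]; simp; positivity
    linarith
  · linarith [p.Phi_pos hx]

lemma hasDerivAt_F (x : ℝ) : HasDerivAt p.F (p.f x) x := by
  have := ((((hasDerivAt_id x).pow 3).div_const 3).sub ((hasDerivAt_id x).const_mul p.B)).const_mul
    p.δ
  refine this.congr_deriv ?_
  simp [f]

lemma hasDerivAt_G (x : ℝ) : HasDerivAt p.G (p.g x) x := by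
  have := ((((hasDerivAt_id x).pow 6).div_const 6).add
    ((((hasDerivAt_id x).pow 4).const_mul (p.a - 1)).div_const 4)).sub
    ((((hasDerivAt_id x).pow 2).const_mul p.a).div_const 2)
  refine this.congr_deriv ?_
  simp [g]; ring

@[fun_prop] lemma continuous_F : Continuous p.F := by unfold F; fun_prop
@[fun_prop] lemma continuous_G : Continuous p.G := by unfold G; fun_prop
@[fun_prop] lemma continuous_f : Continuous p.f := by unfold f; fun_prop
@[fun_prop] lemma continuous_g : Continuous p.g := by unfold g; fun_prop

lemma Psi_eq (x y : ℝ) : 4 * p.Psi x y = (2 * y + p.F x) ^ 2 - p.disc x := by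
  unfold Psi disc; ring

lemma Psi_neg_neg (x y : ℝ) : p.Psi (-x) (-y) = p.Psi x y := by
  unfold Psi F G; ring

lemma Psi_zero_left (y : ℝ) : p.Psi 0 y = y ^ 2 - p.c := by
  unfold Psi F G; ring

lemma Psi_zero_right (x : ℝ) : p.Psi x 0 = 2 * p.G x - p.c := by
  unfold Psi; ring

lemma G_nonpos {x : ℝ} (hx : x ^ 2 ≤ 1) : p.G x ≤ 0 := by
  have ha := p.ha
  have hu := sq_nonneg x
  have : p.G x = x ^ 2 / 12 * (2 * (x ^ 2) ^ 2 + 3 * (p.a - 1) * x ^ 2 - 6 * p.a) := by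
    unfold G; ring
  rw [this]
  apply mul_nonpos_of_nonneg_of_nonpos (by positivity)
  nlinarith [mul_nonneg ha (sub_nonneg.2 hx), mul_nonneg hu (sub_nonneg.2 hx)]

lemma Psi_neg_of_sq_le {x : ℝ} (hx : x ^ 2 ≤ 1) : p.Psi x 0 < 0 := by
  rw [Psi_zero_right]
  linarith [p.G_nonpos hx, p.c_pos]

lemma G_mono {x x' : ℝ} (hx : 1 ≤ x) (hxx' : x ≤ x') : p.G x ≤ p.G x' := by
  have ha := p.ha
  have h1 : 1 ≤ x ^ 2 := by nlinarith
  have h2 : x ^ 2 ≤ x' ^ 2 := by nlinarith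
  have : p.G x' - p.G x = (x' ^ 2 - x ^ 2) / 12 *
      (2 * ((x' ^ 2) ^ 2 + x' ^ 2 * x ^ 2 + (x ^ 2) ^ 2) + 3 * (p.a - 1) * (x' ^ 2 + x ^ 2)
        - 6 * p.a) := by
    unfold G; ring
  have h3 : 0 ≤ (2 * ((x' ^ 2) ^ 2 + x' ^ 2 * x ^ 2 + (x ^ 2) ^ 2)
      + 3 * (p.a - 1) * (x' ^ 2 + x ^ 2) - 6 * p.a) := by
    generalize x ^ 2 = u at *
    generalize x' ^ 2 = v at *
    nlinarith [mul_nonneg ha (by linarith : 0 ≤ u + v - 2),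
      mul_nonneg (by linarith : 0 ≤ u - 1) (by linarith : 0 ≤ v - 1)]
  have h4 : 0 ≤ x' ^ 2 - x ^ 2 := by linarith
  nlinarith [mul_nonneg h4 h3]

lemma c_lt_of_le_sq {x : ℝ} (hx : 3 * p.B ≤ x ^ 2) : p.c < 2 * p.G x := by
  have ha := p.ha
  have hB := p.hB
  have : 2 * p.G x - p.c = (x ^ 2 * (2 * (x ^ 2) ^ 2 + 3 * (p.a - 1) * x ^ 2 - 6 * p.a)
      - p.B ^ 2 * (p.a - 1 + 4 * p.B)) / 6 := by
    unfold G c; ring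
  have h3 : 9 * p.B ^ 2 + 3 * p.a * p.B ≤
      (2 * (x ^ 2) ^ 2 + 3 * (p.a - 1) * x ^ 2 - 6 * p.a) := by
    generalize x ^ 2 = u at *
    have h5 := mul_nonneg ha (by linarith : 0 ≤ u - 3 * p.B)
    have h6 := mul_nonneg (by linarith : 0 ≤ u - 3 * p.B) (by linarith : 0 ≤ u + 3 * p.B)
    have h7 := mul_nonneg (by linarith : 0 ≤ u - 3) (by linarith : 0 ≤ u)
    have h8 := mul_nonneg ha (by linarith : 0 ≤ p.B - 1)
    nlinarith
  have h4 : 3 * p.B * (9 * p.B ^ 2 + 3 * p.a * p.B) ≤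
      x ^ 2 * (2 * (x ^ 2) ^ 2 + 3 * (p.a - 1) * x ^ 2 - 6 * p.a) := by
    apply mul_le_mul hx h3 (by positivity) (by positivity)
  have h9 : 0 ≤ p.a * p.B ^ 2 := by positivity
  have h10 : 0 < p.B ^ 3 := by positivity
  have h11 : 0 < p.B ^ 2 := by positivity
  nlinarith

lemma F_nonpos {x : ℝ} (h0 : 0 ≤ x) (hx : x ^ 2 ≤ 3 * p.B) : p.F x ≤ 0 := by
  have : p.F x = - (p.δ * x * (3 * p.B - x ^ 2) / 3) := by unfold F; ring
  have h := p.hδ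
  have : 0 ≤ 3 * p.B - x ^ 2 := by linarith
  have : 0 ≤ p.δ * x * (3 * p.B - x ^ 2) / 3 := by positivity
  linarith

lemma F_nonneg {x : ℝ} (h0 : 0 ≤ x) (hx : 3 * p.B ≤ x ^ 2) : 0 ≤ p.F x := by
  have : p.F x = (p.δ * x * (x ^ 2 - 3 * p.B) / 3) := by unfold F; ring
  have h := p.hδ
  have : 0 ≤ x ^ 2 - 3 * p.B := by linarith
  have : 0 ≤ p.δ * x * (x ^ 2 - 3 * p.B) / 3 := by positivity
  linarith

/-- A cubic `k₃u³ + k₂u² + k₁u + k₀` with `k₁, k₀ ≥ 0` is `u²` times a convex function on `u > 0`,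
hence its negativity set there is an interval. -/
lemma cubic_neg_of_mem_Icc {k₃ k₂ k₁ k₀ r s u : ℝ} (hk₁ : 0 ≤ k₁) (hk₀ : 0 ≤ k₀) (hr : 0 < r)
    (hru : r ≤ u) (hus : u ≤ s) (h1 : k₃ * r ^ 3 + k₂ * r ^ 2 + k₁ * r + k₀ < 0)
    (h2 : k₃ * s ^ 3 + k₂ * s ^ 2 + k₁ * s + k₀ < 0) :
    k₃ * u ^ 3 + k₂ * u ^ 2 + k₁ * u + k₀ < 0 := by
  rcases hru.eq_or_lt with rfl | hru
  · exact h1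
  rcases hus.eq_or_lt with rfl | hus
  · exact h2
  have hu : 0 < u := hr.trans hru
  have hs : 0 < s := hu.trans hus
  have e : ∀ v : ℝ, 0 < v → k₃ * v ^ 3 + k₂ * v ^ 2 + k₁ * v + k₀ < 0 →
      k₃ * v + k₂ + k₁ * v⁻¹ + k₀ * v⁻¹ ^ 2 < 0 := by
    intro v hv h
    have : k₃ * v + k₂ + k₁ * v⁻¹ + k₀ * v⁻¹ ^ 2 =
      (k₃ * v ^ 3 + k₂ * v ^ 2 + k₁ * v + k₀) / v ^ 2 := by field_simp
    rw [this]; exact div_neg_of_neg_of_pos h (by positivity)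
  have e1 := e r hr h1
  have e2 := e s hs h2
  obtain ⟨l, hl0, hl1, rfl⟩ : ∃ l : ℝ, 0 < l ∧ l < 1 ∧ u = (1 - l) * r + l * s := by
    refine ⟨(u - r) / (s - r), by apply div_pos <;> linarith, by rw [div_lt_one] <;> linarith, ?_⟩
    have : s - r ≠ 0 := by linarith
    field_simp; ring
  set u := (1 - l) * r + l * s
  have hinv : u⁻¹ ≤ (1 - l) * r⁻¹ + l * s⁻¹ := by
    have : (1 - l) * r⁻¹ + l * s⁻¹ - u⁻¹ = l * (1 - l) * (s - r) ^ 2 / (r * s * u) := by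
      field_simp; simp only [u]; ring
    have h3 : 0 ≤ l * (1 - l) * (s - r) ^ 2 / (r * s * u) := by
      have : 0 < 1 - l := by linarith
      positivity
    linarith
  have hsq : u⁻¹ ^ 2 ≤ (1 - l) * r⁻¹ ^ 2 + l * s⁻¹ ^ 2 := by
    have h3 : u⁻¹ ^ 2 ≤ ((1 - l) * r⁻¹ + l * s⁻¹) ^ 2 := by gcongr
    nlinarith [mul_nonneg (mul_nonneg hl0.le (by linarith : 0 ≤ 1 - l)) (sq_nonneg (r⁻¹ - s⁻¹))]
  have : k₃ * u + k₂ + k₁ * u⁻¹ + k₀ * u⁻¹ ^ 2 < 0 := by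
    have := mul_le_mul_of_nonneg_left hinv hk₁
    have := mul_le_mul_of_nonneg_left hsq hk₀
    have : k₃ * u = (1 - l) * (k₃ * r) + l * (k₃ * s) := by simp only [u]; ring
    nlinarith [mul_pos hl0 (neg_pos.2 e2), mul_pos (by linarith : 0 < 1 - l) (neg_pos.2 e1)]
  have h4 : k₃ * u ^ 3 + k₂ * u ^ 2 + k₁ * u + k₀ =
      u ^ 2 * (k₃ * u + k₂ + k₁ * u⁻¹ + k₀ * u⁻¹ ^ 2) := by field_simp
  rw [h4]
  exact mul_neg_of_pos_of_neg (by positivity) this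

lemma disc_neg_of_mem_Icc {x x₁ x₂ : ℝ} (h0 : 0 < x₁) (h1 : x₁ ≤ x) (h2 : x ≤ x₂)
    (hd1 : p.disc x₁ < 0) (hd2 : p.disc x₂ < 0) : p.disc x < 0 := by
  have e : ∀ x, p.disc x = (p.δ ^ 2 / 9 - 4 / 3) * (x ^ 2) ^ 3
      + (-2 * p.δ ^ 2 * p.B / 3 - 2 * (p.a - 1)) * (x ^ 2) ^ 2
      + (p.δ ^ 2 * p.B ^ 2 + 4 * p.a) * x ^ 2 + 4 * p.c := by
    intro x; unfold disc F G; ring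
  have ha := p.ha
  have hc := p.c_pos
  have hx : 0 < x := h0.trans_le h1
  rw [e] at *
  exact cubic_neg_of_mem_Icc (by positivity) (by positivity) (by positivity)
    (by gcongr) (by gcongr) hd1 hd2

lemma disc_neg_of_sq_eq {x : ℝ} (hx : x ^ 2 = 3 * p.B) : p.disc x < 0 := by
  have h1 := p.c_lt_of_le_sq hx.ge
  have h2 : p.F x = 0 := by
    have : p.F x = p.δ * x * (x ^ 2 - 3 * p.B) / 3 := by unfold F; ring
    rw [this, hx]; ring
  unfold disc; rw [h2]; nlinarith

/-- The abscissa of the positive zero of `F`. -/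
def beta : ℝ := Real.sqrt (3 * p.B)

lemma beta_sq : p.beta ^ 2 = 3 * p.B := Real.sq_sqrt (by linarith [p.hB])

lemma one_lt_beta : 1 < p.beta := by
  have := p.beta_sq
  have : 0 ≤ p.beta := Real.sqrt_nonneg _
  nlinarith [p.hB]

lemma disc_beta_neg : p.disc p.beta < 0 := p.disc_neg_of_sq_eq p.beta_sq

lemma disc_nonneg_of_le {x x' : ℝ} (h0 : 0 ≤ x') (h1 : x' ≤ x) (h2 : x ≤ p.beta)
    (h : 0 ≤ p.disc x) : 0 ≤ p.disc x' := by
  rcases h0.eq_or_lt with rfl | h0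
  · have := p.c_pos
    have e : p.disc 0 = 4 * p.c := by unfold disc F G; ring
    rw [e]; positivity
  by_contra! hn
  exact absurd (p.disc_neg_of_mem_Icc h0 h1 h2 hn p.disc_beta_neg) (not_lt.2 h)

lemma disc_nonneg_of_ge {x x' : ℝ} (h0 : p.beta ≤ x) (h1 : x ≤ x')
    (h : 0 ≤ p.disc x) : 0 ≤ p.disc x' := by
  by_contra! hn
  exact absurd (p.disc_neg_of_mem_Icc (by linarith [p.one_lt_beta]) h0 h1 p.disc_beta_neg hn)
    (not_lt.2 h)

lemma beta_sq_le {x : ℝ} (h : p.beta ≤ x) : 3 * p.B ≤ x ^ 2 := by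
  rw [← p.beta_sq]
  have := p.one_lt_beta
  gcongr

lemma sq_le_of_le_beta {x : ℝ} (h0 : 0 ≤ x) (h : x ≤ p.beta) : x ^ 2 ≤ 3 * p.B := by
  rw [← p.beta_sq]
  gcongr

end Params

end

section Flow

variable {E : Type*} [NormedAddCommGroup E] [NormedSpace ℝ E]

/-- A bounded Lipschitz vector field has global integral curves. -/
theorem exists_forall_hasDerivAt_of_lipschitzWith [CompleteSpace E] {v : E → E} {K L : NNReal}
    (hv : LipschitzWith K v) (hL : ∀ x, ‖v x‖ ≤ L) (x₀ : E) :
    ∃ γ : ℝ → E, γ 0 = x₀ ∧ ∀ t, HasDerivAt γ (v (γ t)) t := by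
  have key : ∀ n : ℕ, ∃ α : ℝ → E, α 0 = x₀ ∧
      ∀ t ∈ Ioo (-((n : ℝ) + 1)) (n + 1), HasDerivAt α (v (α t)) t := by
    intro n
    have hn : (0 : ℝ) ≤ n := n.cast_nonneg
    let t₀ : Icc (-((n : ℝ) + 1)) (n + 1) := ⟨0, by constructor <;> linarith⟩
    have hPL : IsPicardLindelof (fun _ => v) t₀ x₀ (L * (n + 1)) 0 L K := by
      apply IsPicardLindelof.of_time_independent (fun x _ => hL x) hv.lipschitzOnWith
      simp [t₀]
    obtain ⟨α, h0, hα⟩ := hPL.exists_eq_forall_mem_Icc_hasDerivWithinAt₀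
    exact ⟨α, h0, fun t ht => (hα t (Ioo_subset_Icc_self ht)).hasDerivAt (Icc_mem_nhds ht.1 ht.2)⟩
  choose α h0 hα using key
  have agree : ∀ n m : ℕ, n ≤ m → EqOn (α n) (α m) (Ioo (-((n : ℝ) + 1)) (n + 1)) := by
    intro n m hnm
    have hn : (0 : ℝ) ≤ n := n.cast_nonneg
    have hnm' : (n : ℝ) ≤ m := by exact_mod_cast hnm
    refine ODE_solution_unique_of_mem_Ioo (v := fun _ => v) (s := fun _ => univ) (K := K)
      (t₀ := 0) (fun t _ => hv.lipschitzOnWith) (by constructor <;> linarith)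
      (fun t ht => ⟨hα n t ht, trivial⟩)
      (fun t ht => ⟨hα m t ⟨by linarith [ht.1], by linarith [ht.2]⟩, trivial⟩) ?_
    rw [h0, h0]
  refine ⟨fun t => α ⌊|t|⌋₊ t, by simp [h0], fun t => ?_⟩
  have ht := Nat.lt_floor_add_one |t|
  refine (hα ⌊|t|⌋₊ t (abs_lt.1 ht)).congr_of_eventuallyEq ?_
  have : ∀ᶠ t' : ℝ in 𝓝 t, |t'| < (⌊|t|⌋₊ : ℝ) + 1 := continuous_abs.continuousAt.eventually_lt_const ht
  filter_upwards [this] with t' ht'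
  refine agree _ _ ?_ (abs_lt.1 (Nat.lt_floor_add_one |t'|))
  rw [← Nat.lt_add_one_iff, Nat.floor_lt (abs_nonneg _)]
  exact_mod_cast ht'

end Flow

noncomputable section

namespace Params

variable (p : Params)

/-- The vector field of system (II). -/
def X (z : ℝ × ℝ) : ℝ × ℝ := (z.2, -p.g z.1 - p.f z.1 * z.2)

/-- `γ` solves system (II) at all times in `s`. -/
def IsSolOn (γ : ℝ → ℝ × ℝ) (s : Set ℝ) : Prop := ∀ t ∈ s, HasDerivAt γ (p.X (γ t)) t

lemma contDiff_X : ContDiff ℝ 1 p.X := by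
  unfold X g f; fun_prop

lemma X_neg (z : ℝ × ℝ) : p.X (-z) = -p.X z := by
  ext
  · simp [X]
  · simp [X, g, f]; ring

lemma exists_lipschitzOnWith_X (M : ℝ) :
    ∃ K, LipschitzOnWith K p.X (Metric.closedBall 0 M) :=
  p.contDiff_X.contDiffOn.exists_lipschitzOnWith one_ne_zero (convex_closedBall 0 M)
    (isCompact_closedBall 0 M)

variable {p} {γ η : ℝ → ℝ × ℝ} {s : Set ℝ} {a b : ℝ}

lemma IsSolOn.mono {s' : Set ℝ} (h : p.IsSolOn γ s) (hs : s' ⊆ s) : p.IsSolOn γ s' :=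
  fun t ht => h t (hs ht)

lemma IsSolOn.continuousAt (h : p.IsSolOn γ s) {t : ℝ} (ht : t ∈ s) : ContinuousAt γ t :=
  (h t ht).continuousAt

lemma IsSolOn.continuousOn (h : p.IsSolOn γ s) : ContinuousOn γ s :=
  fun _ ht => (h.continuousAt ht).continuousWithinAt

lemma IsSolOn.neg (h : p.IsSolOn γ s) : p.IsSolOn (fun t => -γ t) s := by
  intro t ht
  rw [X_neg]
  exact (h t ht).neg

lemma IsSolOn.comp_add_const (h : p.IsSolOn γ s) (u : ℝ) :
    p.IsSolOn (fun t => γ (t + u)) ((fun t => t + u) ⁻¹' s) :=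
  fun t ht => (h (t + u) ht).comp_add_const t u

lemma IsSolOn.fst (h : p.IsSolOn γ s) {t : ℝ} (ht : t ∈ s) :
    HasDerivAt (fun t => (γ t).1) (γ t).2 t :=
  (hasFDerivAt_fst (𝕜 := ℝ) (p := γ t)).comp_hasDerivAt t (h t ht)

lemma IsSolOn.snd (h : p.IsSolOn γ s) {t : ℝ} (ht : t ∈ s) :
    HasDerivAt (fun t => (γ t).2) (-p.g (γ t).1 - p.f (γ t).1 * (γ t).2) t :=
  (hasFDerivAt_snd (𝕜 := ℝ) (p := γ t)).comp_hasDerivAt t (h t ht)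

/-- Uniqueness of solutions on compact intervals. -/
lemma IsSolOn.eqOn (h : p.IsSolOn γ (Icc a b)) (h' : p.IsSolOn η (Icc a b)) {t₀ : ℝ}
    (ht₀ : t₀ ∈ Icc a b) (he : γ t₀ = η t₀) : EqOn γ η (Icc a b) := by
  obtain ⟨M, hM⟩ := (isCompact_Icc.image_of_continuousOn h.continuousOn).isBounded.subset_closedBall 0
  obtain ⟨M', hM'⟩ :=
    (isCompact_Icc.image_of_continuousOn h'.continuousOn).isBounded.subset_closedBall 0
  obtain ⟨K, hK⟩ := p.exists_lipschitzOnWith_X (max M M')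
  have m1 : ∀ t ∈ Icc a b, γ t ∈ Metric.closedBall 0 (max M M') := fun t ht =>
    Metric.closedBall_subset_closedBall (le_max_left _ _) (hM (mem_image_of_mem _ ht))
  have m2 : ∀ t ∈ Icc a b, η t ∈ Metric.closedBall 0 (max M M') := fun t ht =>
    Metric.closedBall_subset_closedBall (le_max_right _ _) (hM' (mem_image_of_mem _ ht))
  have s1 : Icc t₀ b ⊆ Icc a b := Icc_subset_Icc_left ht₀.1
  have s2 : Icc a t₀ ⊆ Icc a b := Icc_subset_Icc_right ht₀.2
  have r1 : Ico t₀ b ⊆ Icc a b := Ico_subset_Icc_self.trans s1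
  have r2 : Ioc a t₀ ⊆ Icc a b := Ioc_subset_Icc_self.trans s2
  have e1 : EqOn γ η (Icc t₀ b) := ODE_solution_unique_of_mem_Icc_right (v := fun _ => p.X)
    (s := fun _ => Metric.closedBall 0 (max M M')) (fun _ _ => hK) (h.continuousOn.mono s1)
    (fun t ht => (h t (r1 ht)).hasDerivWithinAt) (fun t ht => m1 t (r1 ht))
    (h'.continuousOn.mono s1)
    (fun t ht => (h' t (r1 ht)).hasDerivWithinAt) (fun t ht => m2 t (r1 ht)) he
  have e2 : EqOn γ η (Icc a t₀) := ODE_solution_unique_of_mem_Icc_left (v := fun _ => p.X)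
    (s := fun _ => Metric.closedBall 0 (max M M')) (fun _ _ => hK) (h.continuousOn.mono s2)
    (fun t ht => (h t (r2 ht)).hasDerivWithinAt) (fun t ht => m1 t (r2 ht))
    (h'.continuousOn.mono s2)
    (fun t ht => (h' t (r2 ht)).hasDerivWithinAt) (fun t ht => m2 t (r2 ht)) he
  intro t ht
  rcases le_total t₀ t with h1 | h1
  · exact e1 ⟨h1, ht.2⟩
  · exact e2 ⟨ht.1, h1⟩

lemma IsSolOn.eq_univ (h : p.IsSolOn γ univ) (h' : p.IsSolOn η univ) {t₀ : ℝ}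
    (he : γ t₀ = η t₀) : γ = η := by
  ext1 t
  exact (h.mono (subset_univ (Icc (min t t₀) (max t t₀)))).eqOn (h'.mono (subset_univ _))
    ⟨min_le_right _ _, le_max_right _ _⟩ he ⟨min_le_left _ _, le_max_left _ _⟩

variable (p)

/-- Truncation of a real number to `[-M, M]`. -/
def clamp (M x : ℝ) : ℝ := max (-M) (min x M)

lemma clamp_of_abs_le {M x : ℝ} (h : |x| ≤ M) : clamp M x = x := by
  have := abs_le.1 h
  rw [clamp, min_eq_left this.2, max_eq_right this.1]

lemma abs_clamp_le {M x : ℝ} (h : 0 ≤ M) : |clamp M x| ≤ M :=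
  abs_le.2 ⟨le_max_left _ _, max_le (by linarith) (min_le_right _ _)⟩

lemma clamp_neg {M x : ℝ} (h : 0 ≤ M) : clamp M (-x) = -clamp M x := by
  unfold clamp; grind

lemma lipschitzWith_clamp (M : ℝ) : LipschitzWith 1 (clamp M) :=
  (LipschitzWith.id.min_const M).const_max (-M)

/-- The vector field of system (II), truncated outside `[-M, M]²`. -/
def XClamp (M : ℝ) (z : ℝ × ℝ) : ℝ × ℝ := p.X (clamp M z.1, clamp M z.2)

lemma clamp_mem_closedBall {M : ℝ} (h : 0 ≤ M) (z : ℝ × ℝ) :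
    (clamp M z.1, clamp M z.2) ∈ Metric.closedBall (0 : ℝ × ℝ) M := by
  rw [mem_closedBall_zero_iff, Prod.norm_def]
  exact max_le (abs_clamp_le h) (abs_clamp_le h)

lemma exists_lipschitzWith_XClamp {M : ℝ} (h : 0 ≤ M) : ∃ K, LipschitzWith K (p.XClamp M) := by
  obtain ⟨K, hK⟩ := p.exists_lipschitzOnWith_X M
  have h1 : LipschitzWith 1 (fun z : ℝ × ℝ => (clamp M z.1, clamp M z.2)) := by
    have := ((lipschitzWith_clamp M).comp LipschitzWith.prod_fst).prodMk
      ((lipschitzWith_clamp M).comp LipschitzWith.prod_snd)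
    simpa [Function.comp_def] using this
  refine ⟨K, ?_⟩
  intro z w
  refine (hK (clamp_mem_closedBall h z) (clamp_mem_closedBall h w)).trans ?_
  gcongr
  simpa using h1 z w

lemma exists_norm_XClamp_le {M : ℝ} (h : 0 ≤ M) : ∃ L : NNReal, ∀ z, ‖p.XClamp M z‖ ≤ L := by
  obtain ⟨L, hL⟩ := ((isCompact_closedBall (0 : ℝ × ℝ) M).exists_bound_of_continuousOn
    p.contDiff_X.continuous.continuousOn)
  refine ⟨L.toNNReal, fun z => (hL _ (clamp_mem_closedBall h z)).trans ?_⟩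
  exact Real.le_coe_toNNReal L

lemma XClamp_neg {M : ℝ} (h : 0 ≤ M) (z : ℝ × ℝ) : p.XClamp M (-z) = -p.XClamp M z := by
  unfold XClamp
  rw [← X_neg]
  simp [clamp_neg h]

lemma XClamp_of_mem {M : ℝ} {z : ℝ × ℝ} (h1 : |z.1| ≤ M) (h2 : |z.2| ≤ M) :
    p.XClamp M z = p.X z := by
  unfold XClamp
  rw [clamp_of_abs_le h1, clamp_of_abs_le h2]

lemma exists_clamp_solution {M : ℝ} (h : 0 ≤ M) (z : ℝ × ℝ) :
    ∃ γ : ℝ → ℝ × ℝ, γ 0 = z ∧ ∀ t, HasDerivAt γ (p.XClamp M (γ t)) t := by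
  obtain ⟨K, hK⟩ := p.exists_lipschitzWith_XClamp h
  obtain ⟨L, hL⟩ := p.exists_norm_XClamp_le h
  exact exists_forall_hasDerivAt_of_lipschitzWith hK hL z

end Params

end

noncomputable section

lemma exists_mul_pow_le {α : ℝ} (hα : 0 < α) (b : ℝ) {k n : ℕ} (hkn : k < n) :
    ∃ C, ∀ u : ℝ, 0 ≤ u → b * u ^ k ≤ α * u ^ n + C := by
  set R := max 1 (|b| / α)
  have hR : 1 ≤ R := le_max_left _ _
  refine ⟨|b| * R ^ k, fun u hu => ?_⟩
  have hb : b * u ^ k ≤ |b| * u ^ k := by gcongr; exact le_abs_self b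
  rcases le_total u R with h | h
  · have : |b| * u ^ k ≤ |b| * R ^ k := by gcongr
    have : 0 ≤ α * u ^ n := by positivity
    linarith
  · have h1 : 1 ≤ u := hR.trans h
    have h2 : |b| ≤ α * u := by
      have := (le_max_right 1 (|b| / α)).trans h
      rwa [div_le_iff₀' hα] at this
    have h3 : |b| * u ^ k ≤ α * u ^ n := by
      calc |b| * u ^ k ≤ α * u * u ^ k := by gcongr
        _ = α * u ^ (k + 1) := by ring
        _ ≤ α * u ^ n := by gcongr; omega
    have : 0 ≤ |b| * R ^ k := by positivity
    linarith

namespace Params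

variable (p : Params)

lemma exists_G_ge : ∃ C, 0 ≤ C ∧ ∀ x, x ^ 2 ≤ p.G x + C := by
  obtain ⟨C₁, h₁⟩ := exists_mul_pow_le (α := 1 / 12) (by norm_num) (-((p.a - 1) / 4))
    (show 2 < 3 by norm_num)
  obtain ⟨C₂, h₂⟩ := exists_mul_pow_le (α := 1 / 12) (by norm_num) (1 + p.a / 2)
    (show 1 < 3 by norm_num)
  refine ⟨|C₁ + C₂|, abs_nonneg _, fun x => ?_⟩
  have := h₁ (x ^ 2) (sq_nonneg x)
  have := h₂ (x ^ 2) (sq_nonneg x)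
  have := le_abs_self (C₁ + C₂)
  unfold G
  nlinarith

lemma exists_barrier_bound : ∃ C, ∀ x, -(p.F x - x) * p.g x + (p.F x - x) ^ 2 / 2 + p.G x ≤ C := by
  have hδ := p.hδ
  obtain ⟨C₃, h₃⟩ := exists_mul_pow_le (α := p.δ / 9) (by positivity)
    (-p.δ / 3 * (p.a - 1) + (p.δ * p.B + 1) + p.δ ^ 2 / 18 + 1 / 6) (show 3 < 4 by norm_num)
  obtain ⟨C₂, h₂⟩ := exists_mul_pow_le (α := p.δ / 9) (by positivity)
    (p.δ / 3 * p.a + (p.δ * p.B + 1) * (p.a - 1) - p.δ / 3 * (p.δ * p.B + 1) + (p.a - 1) / 4)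
    (show 2 < 4 by norm_num)
  obtain ⟨C₁, h₁⟩ := exists_mul_pow_le (α := p.δ / 9) (by positivity)
    (-(p.δ * p.B + 1) * p.a + (p.δ * p.B + 1) ^ 2 / 2 - p.a / 2) (show 1 < 4 by norm_num)
  refine ⟨C₁ + C₂ + C₃, fun x => ?_⟩
  have := h₁ (x ^ 2) (sq_nonneg x)
  have := h₂ (x ^ 2) (sq_nonneg x)
  have := h₃ (x ^ 2) (sq_nonneg x)
  unfold G F g
  nlinarith

/-- Solutions starting on the `y`-axis not too far from the origin stay in a bounded region. -/
lemma exists_trapping : ∃ M R : ℝ, p.c < M ^ 2 ∧ 0 < M ∧ 0 ≤ R ∧ ∀ Γ : ℝ → ℝ × ℝ,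
    (∀ t, HasDerivAt Γ (p.XClamp R (Γ t)) t) → (Γ 0).1 = 0 → |(Γ 0).2| ≤ M →
    ∀ t, 0 ≤ t → |(Γ t).1| ≤ R ∧ |(Γ t).2| ≤ R ∧ ((Γ t).1 = 0 → |(Γ t).2| ≤ M) := by
  obtain ⟨C, hC0, hC⟩ := p.exists_G_ge
  obtain ⟨D, hD⟩ := p.exists_barrier_bound
  have hc := p.c_pos
  set M : ℝ := 1 + p.c + 2 * |D|
  have hD0 := abs_nonneg D
  have hM1 : 1 ≤ M := by simp only [M]; linarith
  have hMsq : M ≤ M ^ 2 := by nlinarith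
  set N : ℝ := M ^ 2 + 2 * C + 1
  have hN : 1 ≤ N := by simp only [N]; nlinarith
  obtain ⟨E, hE⟩ := (isCompact_Icc (a := -N) (b := N)).exists_bound_of_continuousOn
    (f := fun x => p.F x - x) (by fun_prop)
  set R : ℝ := N + |E|
  have hE0 := abs_nonneg E
  have box : ∀ x y : ℝ, (y + p.F x - x) ^ 2 / 2 + p.G x ≤ M ^ 2 / 2 → |x| ≤ R ∧ |y| ≤ R := by
    intro x y h
    have hx := hC x
    have hx1 : |x| ≤ N := by
      apply abs_le_of_sq_le_sq _ (by linarith)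
      nlinarith [sq_nonneg (y + p.F x - x)]
    have hn : |y + p.F x - x| ≤ N := by
      apply abs_le_of_sq_le_sq _ (by linarith)
      nlinarith [sq_nonneg x]
    have h3 := hE x (abs_le.1 hx1)
    rw [Real.norm_eq_abs] at h3
    have h4 := le_abs_self E
    refine ⟨by simp only [R]; linarith, ?_⟩
    have : |y| = |(y + p.F x - x) - (p.F x - x)| := by congr 1; ring
    rw [this]
    refine (abs_sub _ _).trans ?_
    simp only [R]; linarith
  refine ⟨M, R, by simp only [M] at *; nlinarith, by linarith, by simp only [R]; linarith, ?_⟩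
  intro Γ hΓ h0 hs t ht
  have d1 : ∀ t, HasDerivAt (fun t => (Γ t).1) (p.XClamp R (Γ t)).1 t := fun t =>
    (hasFDerivAt_fst (𝕜 := ℝ) (p := Γ t)).comp_hasDerivAt t (hΓ t)
  have d2 : ∀ t, HasDerivAt (fun t => (Γ t).2) (p.XClamp R (Γ t)).2 t := fun t =>
    (hasFDerivAt_snd (𝕜 := ℝ) (p := Γ t)).comp_hasDerivAt t (hΓ t)
  have dθ : ∀ t, HasDerivAt
      (fun t => ((Γ t).2 + p.F (Γ t).1 - (Γ t).1) ^ 2 / 2 + p.G (Γ t).1)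
      (((Γ t).2 + p.F (Γ t).1 - (Γ t).1) * ((p.XClamp R (Γ t)).2
        + p.f (Γ t).1 * (p.XClamp R (Γ t)).1 - (p.XClamp R (Γ t)).1)
        + p.g (Γ t).1 * (p.XClamp R (Γ t)).1) t := by
    intro t
    have e1 := (p.hasDerivAt_F (Γ t).1).comp t (d1 t)
    have e2 := (p.hasDerivAt_G (Γ t).1).comp t (d1 t)
    refine ((((((d2 t).add e1).sub (d1 t)).pow 2).div_const 2).add e2).congr_deriv ?_
    simp; ring
  have key : ((Γ t).2 + p.F (Γ t).1 - (Γ t).1) ^ 2 / 2 + p.G (Γ t).1 ≤ M ^ 2 / 2 := by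
    refine image_le_of_deriv_right_lt_deriv_boundary' (a := 0) (b := t)
      (f := fun t => ((Γ t).2 + p.F (Γ t).1 - (Γ t).1) ^ 2 / 2 + p.G (Γ t).1)
      (fun t _ => (dθ t).continuousAt.continuousWithinAt) (fun t _ => (dθ t).hasDerivWithinAt)
      (B := fun _ => M ^ 2 / 2) (B' := fun _ => 0) ?_ continuousOn_const
      (fun t _ => (hasDerivAt_const _ _).hasDerivWithinAt) ?_ ⟨ht, le_rfl⟩
    · have := abs_le.1 hs
      simp only [h0]
      have e : p.F 0 = 0 := by simp [F]
      have e' : p.G 0 = 0 := by simp [G]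
      rw [e, e']
      nlinarith
    · intro t _ h
      obtain ⟨b1, b2⟩ := box _ _ h.le
      rw [p.XClamp_of_mem b1 b2]
      have h5 := hD (Γ t).1
      have h6 := le_abs_self D
      simp only [X]
      have h7 : 2 * D < M ^ 2 := by
        have : 2 * |D| < M := by simp only [M]; linarith
        linarith
      generalize (Γ t).1 = x at *
      generalize (Γ t).2 = y at *
      nlinarith [sq_nonneg (y + p.F x - x - (p.F x - x))]
  obtain ⟨b1, b2⟩ := box _ _ key
  refine ⟨b1, b2, fun hx => ?_⟩
  apply abs_le_of_sq_le_sq _ (by linarith)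
  rw [hx] at key
  have e : p.F 0 = 0 := by simp [F]
  have e' : p.G 0 = 0 := by simp [G]
  rw [e, e'] at key
  linarith

end Params

end

noncomputable section

namespace Params

variable {p : Params} {γ : ℝ → ℝ × ℝ} {s : Set ℝ} {a b : ℝ}

@[fun_prop] lemma continuous_Psi (p : Params) : Continuous fun z : ℝ × ℝ => p.Psi z.1 z.2 := by
  unfold Psi; fun_prop

lemma IsSolOn.hasDerivAt_Psi (h : p.IsSolOn γ s) {t : ℝ} (ht : t ∈ s) :
    HasDerivAt (fun t => p.Psi (γ t).1 (γ t).2)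
      (-p.f (γ t).1 * p.Psi (γ t).1 (γ t).2 + p.Phi (γ t).1) t := by
  have e1 := (p.hasDerivAt_F (γ t).1).comp t (h.fst ht)
  have e2 := (p.hasDerivAt_G (γ t).1).comp t (h.fst ht)
  refine ((((h.snd ht).pow 2).add (e1.mul (h.snd ht))).add
    ((e2.const_mul 2).sub_const p.c)).congr_deriv ?_
  rw [← Phi_eq]
  simp [Psi]; ring

lemma IsSolOn.Psi_pos (h : p.IsSolOn γ (Icc a b)) (hab : a < b)
    (h0 : 0 ≤ p.Psi (γ a).1 (γ a).2) : 0 < p.Psi (γ b).1 (γ b).2 := by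
  set φ : ℝ → ℝ := fun t => p.f (γ (projIcc a b hab.le t)).1
  have hφ : Continuous φ := by
    have : Continuous fun t => γ (projIcc a b hab.le t) :=
      h.continuousOn.comp_continuous (by fun_prop) (fun t => (projIcc a b hab.le t).2)
    exact p.continuous_f.comp (continuous_fst.comp this)
  have hφe : ∀ t ∈ Icc a b, φ t = p.f (γ t).1 := fun t ht => by
    simp only [φ]; rw [projIcc_of_mem _ ht]
  set Q : ℝ → ℝ := fun t => p.Psi (γ t).1 (γ t).2 * Real.exp (∫ u in a..t, φ u)
  have dQ : ∀ t ∈ Icc a b, HasDerivAt Q (p.Phi (γ t).1 * Real.exp (∫ u in a..t, φ u)) t := by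
    intro t ht
    have e1 : HasDerivAt (fun t => ∫ u in a..t, φ u) (φ t) t :=
      (hφ.integral_hasStrictDerivAt a t).hasDerivAt
    refine ((h.hasDerivAt_Psi ht).mul e1.exp).congr_deriv ?_
    rw [hφe t ht]; ring
  have mono : MonotoneOn Q (Icc a b) := by
    refine monotoneOn_of_deriv_nonneg (convex_Icc a b)
      (fun t ht => (dQ t ht).continuousAt.continuousWithinAt) ?_ ?_
    · intro t ht
      exact (dQ t (interior_subset ht)).differentiableAt.differentiableWithinAt
    · intro t ht
      rw [(dQ t (interior_subset ht)).deriv]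
      have := p.Phi_nonneg (γ t).1
      positivity
  by_contra! hb
  have Q0 : 0 ≤ Q a := mul_nonneg h0 (Real.exp_pos _).le
  have Q1 : Q b ≤ 0 := mul_nonpos_of_nonpos_of_nonneg hb (Real.exp_pos _).le
  have Qz : ∀ t ∈ Icc a b, Q t = 0 := fun t ht => le_antisymm
    ((mono ht (right_mem_Icc.2 hab.le) ht.2).trans Q1)
    (Q0.trans (mono (left_mem_Icc.2 hab.le) ht ht.1))
  have Phiz : ∀ t ∈ Ioo a b, p.Phi (γ t).1 = 0 := by
    intro t ht
    have hz : Q =ᶠ[𝓝 t] fun _ => 0 := by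
      filter_upwards [Icc_mem_nhds ht.1 ht.2] with u hu using Qz u hu
    have := (dQ t (Ioo_subset_Icc_self ht)).unique
      ((hasDerivAt_const t (0 : ℝ)).congr_of_eventuallyEq hz)
    simpa [(Real.exp_pos _).ne'] using this
  set m := (a + b) / 2
  have hm : m ∈ Ioo a b := by constructor <;> simp only [m] <;> linarith
  have hm' := Ioo_subset_Icc_self hm
  have sq1 : ∀ t ∈ Ioo a b, (γ t).1 ^ 2 = 1 := fun t ht => p.sq_eq_one_of_Phi_eq_zero (Phiz t ht)
  have d : 2 * (γ m).1 * (γ m).2 = 0 := by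
    have hz : (fun t => (γ t).1 ^ 2) =ᶠ[𝓝 m] fun _ => 1 := by
      filter_upwards [Ioo_mem_nhds hm.1 hm.2] with u hu using sq1 u hu
    have := ((h.fst hm').pow 2).unique ((hasDerivAt_const m (1 : ℝ)).congr_of_eventuallyEq hz)
    simpa using this
  have hx := sq1 m hm
  have hx0 : (γ m).1 ≠ 0 := by intro h; rw [h] at hx; norm_num at hx
  have hy : (γ m).2 = 0 := by simpa [hx0] using d
  have hP := Qz m hm'
  have : p.Psi (γ m).1 (γ m).2 = 0 := by simpa [Q, (Real.exp_pos _).ne'] using hP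
  rw [hy] at this
  linarith [p.Psi_neg_of_sq_le hx.le]

lemma IsSolOn.periodic_dichotomy (h : p.IsSolOn γ univ) {T : ℝ} (hT : 0 < T)
    (hper : Function.Periodic γ T) :
    (∀ t, 0 < p.Psi (γ t).1 (γ t).2) ∨ ∀ t, p.Psi (γ t).1 (γ t).2 < 0 := by
  by_cases hn : ∀ t, p.Psi (γ t).1 (γ t).2 < 0
  · exact Or.inr hn
  push Not at hn
  obtain ⟨t₀, ht₀⟩ := hn
  left
  intro t
  obtain ⟨n, hn⟩ := exists_nat_gt ((t₀ - t) / T)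
  rw [div_lt_iff₀ hT] at hn
  rw [← hper.nat_mul n t]
  exact (h.mono (subset_univ (Icc t₀ (t + n * T)))).Psi_pos (by linarith) ht₀

/-- Time shift of a solution. -/
lemma IsSolOn.shift_univ (h : p.IsSolOn γ univ) (u : ℝ) :
    p.IsSolOn (fun t => γ (t + u)) univ := fun t _ => (h (t + u) trivial).comp_add_const t u

/-- A solution through an equilibrium is constant. -/
lemma IsSolOn.g_ne_zero (h : p.IsSolOn γ univ) (hn : ¬ ∀ t s, γ t = γ s) {t : ℝ}
    (hy : (γ t).2 = 0) : p.g (γ t).1 ≠ 0 := by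
  intro hg
  apply hn
  have hc : p.IsSolOn (fun _ => γ t) univ := by
    intro u _
    have : p.X (γ t) = 0 := by
      ext <;> simp [X, hy, hg]
    rw [this]
    exact hasDerivAt_const _ _
  have := h.eq_univ hc (t₀ := t) rfl
  intro u v
  rw [this]

end Params

end

/-- The part of a trajectory of `x' = y`, `y' = k` in `y > 0` is a graph over the `x`-axis. -/
theorem exists_graph_of_pos {x y k : ℝ → ℝ} {a b : ℝ} (hab : a < b)
    (hx : ∀ t ∈ Icc a b, HasDerivAt x (y t) t) (hy : ∀ t ∈ Icc a b, HasDerivAt y (k t) t)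
    (hpos : ∀ t ∈ Ioo a b, 0 < y t) :
    x '' Icc a b = Icc (x a) (x b) ∧ x '' Ioo a b = Ioo (x a) (x b) ∧ StrictMonoOn x (Icc a b) ∧
    ∃ Y : ℝ → ℝ, ContinuousOn Y (Icc (x a) (x b)) ∧ (∀ t ∈ Icc a b, Y (x t) = y t) ∧
      ∀ t ∈ Ioo a b, HasDerivAt Y (k t / y t) (x t) := by
  have cx : ContinuousOn x (Icc a b) := fun t ht => (hx t ht).continuousAt.continuousWithinAt
  have cy : ContinuousOn y (Icc a b) := fun t ht => (hy t ht).continuousAt.continuousWithinAt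
  have mono : StrictMonoOn x (Icc a b) := by
    refine strictMonoOn_of_deriv_pos (convex_Icc a b) cx fun t ht => ?_
    rw [(hx t (interior_subset ht)).deriv]
    rw [interior_Icc] at ht
    exact hpos t ht
  have ha := left_mem_Icc.2 hab.le
  have hb := right_mem_Icc.2 hab.le
  have im1 : x '' Icc a b = Icc (x a) (x b) := by
    refine Subset.antisymm ?_ (intermediate_value_Icc hab.le cx)
    rintro _ ⟨t, ht, rfl⟩
    exact ⟨mono.monotoneOn ha ht ht.1, mono.monotoneOn ht hb ht.2⟩
  have im2 : x '' Ioo a b = Ioo (x a) (x b) := by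
    refine Subset.antisymm ?_ (intermediate_value_Ioo hab.le cx)
    rintro _ ⟨t, ht, rfl⟩
    have ht' := Ioo_subset_Icc_self ht
    exact ⟨mono ha ht' ht.1, mono ht' hb ht.2⟩
  refine ⟨im1, im2, mono, ?_⟩
  set τ : ℝ → ℝ := Function.invFunOn x (Icc a b)
  have hτ : ∀ t ∈ Icc a b, τ (x t) = t := fun t ht => mono.injOn.leftInvOn_invFunOn ht
  have cτ : ContinuousOn τ (Icc (x a) (x b)) := by
    rw [← im1, continuousOn_iff_isClosed]
    intro C hC
    refine ⟨x '' (Icc a b ∩ C), ((isCompact_Icc.inter_right hC).image_of_continuousOn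
      (cx.mono inter_subset_left)).isClosed, ?_⟩
    ext ξ
    constructor
    · rintro ⟨h1, t, ht, rfl⟩
      rw [mem_preimage, hτ t ht] at h1
      exact ⟨⟨t, ⟨ht, h1⟩, rfl⟩, ⟨t, ht, rfl⟩⟩
    · rintro ⟨⟨t, ht, rfl⟩, h2⟩
      refine ⟨?_, h2⟩
      rw [mem_preimage, hτ t ht.1]
      exact ht.2
  have mτ : MapsTo τ (Icc (x a) (x b)) (Icc a b) := by
    rw [← im1]
    rintro _ ⟨t, ht, rfl⟩
    rwa [hτ t ht]
  refine ⟨y ∘ τ, cy.comp cτ mτ, fun t ht => by simp [hτ t ht], fun t ht => ?_⟩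
  have ht' := Ioo_subset_Icc_self ht
  have hξ : x t ∈ Ioo (x a) (x b) := im2 ▸ mem_image_of_mem x ht
  have nh : Icc (x a) (x b) ∈ 𝓝 (x t) := Icc_mem_nhds hξ.1 hξ.2
  have d : HasDerivAt τ (y t)⁻¹ (x t) := by
    refine HasDerivAt.of_local_left_inverse (cτ.continuousAt nh) (f := x) ?_ (hpos t ht).ne' ?_
    · rw [hτ t ht']; exact hx t ht'
    · filter_upwards [nh] with ξ hξ
      rw [← im1] at hξ
      obtain ⟨u, hu, rfl⟩ := hξ
      rw [hτ u hu]
  have d2 : HasDerivAt y (k t) (τ (x t)) := by rw [hτ t ht']; exact hy t ht'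
  exact d2.comp (x t) d

noncomputable section

namespace Params

variable (p : Params)

/-- `Y` is an arc of a trajectory over `[q, r]`, away from the `x`-axis except possibly at the
endpoints. -/
structure IsArc (Y : ℝ → ℝ) (q r : ℝ) : Prop where
  continuousOn : ContinuousOn Y (Icc q r)
  ne_zero : ∀ x ∈ Ioo q r, Y x ≠ 0
  hasDerivAt : ∀ x ∈ Ioo q r, HasDerivAt Y ((-p.g x - p.f x * Y x) / Y x) x

variable {p}

lemma IsArc.mono {Y : ℝ → ℝ} {q r q' r' : ℝ} (h : p.IsArc Y q r) (hq : q ≤ q') (hr : r' ≤ r) :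
    p.IsArc Y q' r' :=
  ⟨h.continuousOn.mono (Icc_subset_Icc hq hr), fun x hx => h.ne_zero x (Ioo_subset_Ioo hq hr hx),
    fun x hx => h.hasDerivAt x (Ioo_subset_Ioo hq hr hx)⟩

variable {γ : ℝ → ℝ × ℝ} {a b : ℝ}

lemma IsSolOn.exists_upper_arc (h : p.IsSolOn γ (Icc a b)) (hab : a < b)
    (hpos : ∀ t ∈ Ioo a b, 0 < (γ t).2) :
    StrictMonoOn (fun t => (γ t).1) (Icc a b) ∧
    (∀ ξ ∈ Icc (γ a).1 (γ b).1, ∃ t ∈ Icc a b, (γ t).1 = ξ) ∧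
    ∃ Y : ℝ → ℝ, p.IsArc Y (γ a).1 (γ b).1 ∧ (∀ t ∈ Icc a b, Y (γ t).1 = (γ t).2) ∧
      ∀ ξ ∈ Ioo (γ a).1 (γ b).1, 0 < Y ξ := by
  obtain ⟨im1, im2, mono, Y, cY, hY, dY⟩ :=
    exists_graph_of_pos hab (fun t ht => h.fst ht) (fun t ht => h.snd ht) hpos
  have key : ∀ ξ ∈ Ioo (γ a).1 (γ b).1, ∃ t ∈ Ioo a b, (γ t).1 = ξ := by
    intro ξ hξ
    rw [← im2] at hξ
    exact hξ
  refine ⟨mono, fun ξ hξ => ?_, Y, ⟨cY, fun ξ hξ => ?_, fun ξ hξ => ?_⟩, hY, fun ξ hξ => ?_⟩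
  · rw [← im1] at hξ; exact hξ
  · obtain ⟨t, ht, rfl⟩ := key ξ hξ
    rw [hY t (Ioo_subset_Icc_self ht)]
    exact (hpos t ht).ne'
  · obtain ⟨t, ht, rfl⟩ := key ξ hξ
    rw [hY t (Ioo_subset_Icc_self ht)]
    exact dY t ht
  · obtain ⟨t, ht, rfl⟩ := key ξ hξ
    rw [hY t (Ioo_subset_Icc_self ht)]
    exact hpos t ht

lemma IsSolOn.exists_lower_arc (h : p.IsSolOn γ (Icc a b)) (hab : a < b)
    (hneg : ∀ t ∈ Ioo a b, (γ t).2 < 0) :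
    StrictAntiOn (fun t => (γ t).1) (Icc a b) ∧
    (∀ ξ ∈ Icc (γ b).1 (γ a).1, ∃ t ∈ Icc a b, (γ t).1 = ξ) ∧
    ∃ Y : ℝ → ℝ, p.IsArc Y (γ b).1 (γ a).1 ∧ (∀ t ∈ Icc a b, Y (γ t).1 = (γ t).2) ∧
      ∀ ξ ∈ Ioo (γ b).1 (γ a).1, Y ξ < 0 := by
  have m : ∀ t ∈ Icc (-b) (-a), -t ∈ Icc a b := fun t ht =>
    ⟨by linarith [ht.2], by linarith [ht.1]⟩
  have m' : ∀ t ∈ Icc a b, -t ∈ Icc (-b) (-a) := fun t ht =>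
    ⟨by linarith [ht.2], by linarith [ht.1]⟩
  have n : ∀ t ∈ Ioo (-b) (-a), -t ∈ Ioo a b := fun t ht =>
    ⟨by linarith [ht.2], by linarith [ht.1]⟩
  obtain ⟨im1, im2, mono, Z, cZ, hZ, dZ⟩ :=
    exists_graph_of_pos (x := fun t => (γ (-t)).1) (y := fun t => -(γ (-t)).2)
      (k := fun t => -p.g (γ (-t)).1 - p.f (γ (-t)).1 * (γ (-t)).2) (neg_lt_neg hab)
      (fun t ht => ((h.fst (m t ht)).comp t (hasDerivAt_neg t)).congr_deriv (by ring))
      (fun t ht => (((h.snd (m t ht)).comp t (hasDerivAt_neg t)).neg).congr_deriv (by ring))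
      (fun t ht => by have := hneg _ (n t ht); simpa using this)
  simp only [neg_neg] at im1 im2 cZ
  have key : ∀ ξ ∈ Ioo (γ b).1 (γ a).1, ∃ t ∈ Ioo (-b) (-a), (γ (-t)).1 = ξ := by
    intro ξ hξ
    rw [← im2] at hξ
    exact hξ
  refine ⟨?_, fun ξ hξ => ?_, fun ξ => -Z ξ, ⟨cZ.neg, fun ξ hξ => ?_, fun ξ hξ => ?_⟩, ?_,
    fun ξ hξ => ?_⟩
  · intro t ht u hu htu
    have := mono (m' u hu) (m' t ht) (neg_lt_neg htu)
    simpa using this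
  · rw [← im1] at hξ
    obtain ⟨t, ht, rfl⟩ := hξ
    exact ⟨-t, m t ht, rfl⟩
  · obtain ⟨t, ht, rfl⟩ := key ξ hξ
    have e := hZ t (Ioo_subset_Icc_self ht)
    rw [e, neg_neg]
    exact (hneg _ (n t ht)).ne
  · obtain ⟨t, ht, rfl⟩ := key ξ hξ
    have e := hZ t (Ioo_subset_Icc_self ht)
    have d := (dZ t ht).neg
    rw [e, neg_neg]
    refine d.congr_deriv ?_
    rw [div_neg, neg_neg]
  · intro t ht
    have e := hZ (-t) (m' t ht)
    simp only [neg_neg] at e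
    simp only [e, neg_neg]
  · obtain ⟨t, ht, rfl⟩ := key ξ hξ
    have e := hZ t (Ioo_subset_Icc_self ht)
    simp only [e, neg_neg]
    exact hneg _ (n t ht)

end Params

end

section ParametricIntegral

theorem intervalIntegrable_of_continuousOn_prod {J : ℝ → ℝ → ℝ} {S : Set ℝ} {x c d : ℝ}
    (hcd : c ≤ d) (hx : x ∈ S) (cJ : ContinuousOn (Function.uncurry J) (S ×ˢ Icc c d)) :
    IntervalIntegrable (J x) MeasureTheory.volume c d := by
  apply ContinuousOn.intervalIntegrable
  rw [uIcc_of_le hcd]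
  exact cJ.comp (f := fun t => (x, t)) (by fun_prop) (fun t ht => ⟨hx, ht⟩)

theorem hasDerivAt_integral_of_continuousOn_prod {J D : ℝ → ℝ → ℝ} {l u x c d : ℝ} (hcd : c ≤ d)
    (hx : x ∈ Ioo l u) (cJ : ContinuousOn (Function.uncurry J) (Icc l u ×ˢ Icc c d))
    (cD : ContinuousOn (Function.uncurry D) (Icc l u ×ˢ Icc c d))
    (hd : ∀ x ∈ Icc l u, ∀ t ∈ Icc c d, HasDerivAt (fun x => J x t) (D x t) x) :
    HasDerivAt (fun x => ∫ t in c..d, J x t) (∫ t in c..d, D x t) x := by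
  obtain ⟨C, hC⟩ := (isCompact_Icc.prod isCompact_Icc).exists_bound_of_continuousOn cD
  have nh : Icc l u ∈ 𝓝 x := Icc_mem_nhds hx.1 hx.2
  have sub : uIoc c d ⊆ Icc c d := by rw [uIoc_of_le hcd]; exact Ioc_subset_Icc_self
  have hx' := Ioo_subset_Icc_self hx
  refine (intervalIntegral.hasDerivAt_integral_of_dominated_loc_of_deriv_le (bound := fun _ => C)
    nh ?_ (intervalIntegrable_of_continuousOn_prod hcd hx' cJ) ?_ ?_ (by simp) ?_).2
  · filter_upwards [nh] with v hv
    exact (intervalIntegrable_of_continuousOn_prod hcd hv cJ).aestronglyMeasurable_restrict_uIoc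
  · exact (intervalIntegrable_of_continuousOn_prod hcd hx' cD).aestronglyMeasurable_restrict_uIoc
  · exact Eventually.of_forall fun t ht v hv => hC (v, t) ⟨hv, sub ht⟩
  · exact Eventually.of_forall fun t ht v hv => hd v hv t (sub ht)

theorem continuousOn_integral_of_continuousOn_prod {J : ℝ → ℝ → ℝ} {S : Set ℝ} {c d : ℝ}
    (hcd : c ≤ d) (cJ : ContinuousOn (Function.uncurry J) (S ×ˢ Icc c d)) :
    ContinuousOn (fun x => ∫ t in c..d, J x t) S := by
  rw [continuousOn_iff_continuous_domRestrict]
  have : S.domRestrict (fun x => ∫ t in c..d, J x t) =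
      fun x : S => ∫ t in c..d, J x (projIcc c d hcd t) := by
    ext x
    apply intervalIntegral.integral_congr
    intro t ht
    rw [uIcc_of_le hcd] at ht
    simp only
    rw [projIcc_of_mem _ ht]
  rw [this]
  apply intervalIntegral.continuous_parametric_intervalIntegral_of_continuous'
    (f := fun (x : S) t => J x (projIcc c d hcd t))
  exact cJ.comp_continuous (f := fun z : S × ℝ => ((z.1 : ℝ), (projIcc c d hcd z.2 : ℝ)))
    (by fun_prop) (fun z => ⟨z.1.2, (projIcc c d hcd z.2).2⟩)

end ParametricIntegral

noncomputable section

namespace Params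

variable (p : Params)

/-- The integral of `y dy / Ψ` over a vertical segment. -/
def stripInt (y₁ y₂ x : ℝ) : ℝ := ∫ s in y₁..y₂, s / p.Psi x s

lemma stripInt_eq (y₁ y₂ x : ℝ) : p.stripInt y₁ y₂ x =
    ∫ t in (0 : ℝ)..1, (y₂ - y₁) * ((y₁ + (y₂ - y₁) * t) / p.Psi x (y₁ + (y₂ - y₁) * t)) := by
  have := intervalIntegral.mul_integral_comp_add_mul (a := 0) (b := 1)
    (f := fun s => s / p.Psi x s) (y₂ - y₁) y₁
  rw [intervalIntegral.integral_const_mul, this, stripInt]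
  simp

/-- The derivative along the arcs of the integrand of `stripInt_eq`. -/
def stripDeriv (x y₁ y₂ m₁ m₂ t : ℝ) : ℝ :=
  (m₂ - m₁) * ((y₁ + (y₂ - y₁) * t) / p.Psi x (y₁ + (y₂ - y₁) * t)) +
  (y₂ - y₁) * (((m₁ + (m₂ - m₁) * t) * p.Psi x (y₁ + (y₂ - y₁) * t) - (y₁ + (y₂ - y₁) * t) *
    (p.f x * (y₁ + (y₂ - y₁) * t) + 2 * p.g x + (2 * (y₁ + (y₂ - y₁) * t) + p.F x) *
      (m₁ + (m₂ - m₁) * t))) / p.Psi x (y₁ + (y₂ - y₁) * t) ^ 2)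

lemma hasDerivAt_strip {Y₁ Y₂ : ℝ → ℝ} {x m₁ m₂ t : ℝ} (h₁ : HasDerivAt Y₁ m₁ x)
    (h₂ : HasDerivAt Y₂ m₂ x) (hΨ : p.Psi x (Y₁ x + (Y₂ x - Y₁ x) * t) ≠ 0) :
    HasDerivAt (fun x => (Y₂ x - Y₁ x) * ((Y₁ x + (Y₂ x - Y₁ x) * t) /
      p.Psi x (Y₁ x + (Y₂ x - Y₁ x) * t))) (p.stripDeriv x (Y₁ x) (Y₂ x) m₁ m₂ t) x := by
  have hs := h₁.add ((h₂.sub h₁).mul_const t)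
  have hP : HasDerivAt (fun x => p.Psi x (Y₁ x + (Y₂ x - Y₁ x) * t))
      (p.f x * (Y₁ x + (Y₂ x - Y₁ x) * t) + 2 * p.g x + (2 * (Y₁ x + (Y₂ x - Y₁ x) * t) + p.F x) *
      (m₁ + (m₂ - m₁) * t)) x := by
    refine (((hs.pow 2).add ((p.hasDerivAt_F x).mul hs)).add
      (((p.hasDerivAt_G x).const_mul 2).sub_const p.c)).congr_deriv ?_
    simp; ring
  exact (h₂.sub h₁).mul (hs.div hP hΨ)

lemma hasDerivAt_strip_boundary {x y₁ y₂ m₁ m₂ t : ℝ}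
    (hΨ : p.Psi x (y₁ + (y₂ - y₁) * t) ≠ 0) :
    HasDerivAt (fun t => (y₁ + (y₂ - y₁) * t) / p.Psi x (y₁ + (y₂ - y₁) * t) *
        (m₁ + (m₂ - m₁) * t) -
        (-p.g x - p.f x * (y₁ + (y₂ - y₁) * t)) / p.Psi x (y₁ + (y₂ - y₁) * t))
      (p.stripDeriv x y₁ y₂ m₁ m₂ t +
        (y₂ - y₁) * (p.Phi x / p.Psi x (y₁ + (y₂ - y₁) * t) ^ 2)) t := by
  have hs : HasDerivAt (fun t => y₁ + (y₂ - y₁) * t) (y₂ - y₁) t := by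
    simpa using ((hasDerivAt_id t).const_mul (y₂ - y₁)).const_add y₁
  have hm : HasDerivAt (fun t => m₁ + (m₂ - m₁) * t) (m₂ - m₁) t := by
    simpa using ((hasDerivAt_id t).const_mul (m₂ - m₁)).const_add m₁
  have hP : HasDerivAt (fun t => p.Psi x (y₁ + (y₂ - y₁) * t))
      ((2 * (y₁ + (y₂ - y₁) * t) + p.F x) * (y₂ - y₁)) t := by
    refine (((hs.pow 2).add (hs.const_mul (p.F x))).add_const (2 * p.G x - p.c)).congr_deriv ?_
    simp; ring
  refine (((hs.div hP hΨ).mul hm).sub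
    (((hs.const_mul (p.f x)).const_sub (-p.g x)).div hP hΨ)).congr_deriv ?_
  unfold stripDeriv
  rw [← Phi_eq]
  simp only [Pi.div_apply]
  generalize y₁ + (y₂ - y₁) * t = s at *
  have e : p.Psi x s = s ^ 2 + p.F x * s + (2 * p.G x - p.c) := rfl
  field_simp
  rw [e]
  ring

variable {p}

lemma continuousOn_strip {Y₁ Y₂ : ℝ → ℝ} {S : Set ℝ} (h₁ : ContinuousOn Y₁ S)
    (h₂ : ContinuousOn Y₂ S)
    (hΨ : ∀ x ∈ S, ∀ t ∈ Icc (0 : ℝ) 1, p.Psi x (Y₁ x + (Y₂ x - Y₁ x) * t) ≠ 0) :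
    ContinuousOn (Function.uncurry fun x t => (Y₂ x - Y₁ x) * ((Y₁ x + (Y₂ x - Y₁ x) * t) /
      p.Psi x (Y₁ x + (Y₂ x - Y₁ x) * t))) (S ×ˢ Icc 0 1) := by
  have c₁ : ContinuousOn (fun z : ℝ × ℝ => Y₁ z.1) (S ×ˢ Icc 0 1) :=
    h₁.comp continuousOn_fst fun z hz => hz.1
  have c₂ : ContinuousOn (fun z : ℝ × ℝ => Y₂ z.1) (S ×ˢ Icc 0 1) :=
    h₂.comp continuousOn_fst fun z hz => hz.1
  have cs := c₁.add ((c₂.sub c₁).mul continuousOn_snd)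
  exact (c₂.sub c₁).mul (cs.div (p.continuous_Psi.comp_continuousOn (continuousOn_fst.prodMk cs))
    fun z hz => hΨ z.1 hz.1 z.2 hz.2)

lemma continuousOn_stripDeriv {Y₁ Y₂ m₁ m₂ : ℝ → ℝ} {S : Set ℝ} (h₁ : ContinuousOn Y₁ S)
    (h₂ : ContinuousOn Y₂ S) (hm₁ : ContinuousOn m₁ S) (hm₂ : ContinuousOn m₂ S)
    (hΨ : ∀ x ∈ S, ∀ t ∈ Icc (0 : ℝ) 1, p.Psi x (Y₁ x + (Y₂ x - Y₁ x) * t) ≠ 0) :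
    ContinuousOn (Function.uncurry fun x t => p.stripDeriv x (Y₁ x) (Y₂ x) (m₁ x) (m₂ x) t)
      (S ×ˢ Icc 0 1) := by
  have c₁ : ContinuousOn (fun z : ℝ × ℝ => Y₁ z.1) (S ×ˢ Icc 0 1) :=
    h₁.comp continuousOn_fst fun z hz => hz.1
  have c₂ : ContinuousOn (fun z : ℝ × ℝ => Y₂ z.1) (S ×ˢ Icc 0 1) :=
    h₂.comp continuousOn_fst fun z hz => hz.1
  have d₁ : ContinuousOn (fun z : ℝ × ℝ => m₁ z.1) (S ×ˢ Icc 0 1) :=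
    hm₁.comp continuousOn_fst fun z hz => hz.1
  have d₂ : ContinuousOn (fun z : ℝ × ℝ => m₂ z.1) (S ×ˢ Icc 0 1) :=
    hm₂.comp continuousOn_fst fun z hz => hz.1
  have cs := c₁.add ((c₂.sub c₁).mul continuousOn_snd)
  have cm := d₁.add ((d₂.sub d₁).mul continuousOn_snd)
  have cP := p.continuous_Psi.comp_continuousOn (continuousOn_fst.prodMk cs)
  have cf := (p.continuous_f.comp_continuousOn (continuousOn_fst (s := S ×ˢ Icc (0 : ℝ) 1)))
  have cg := (p.continuous_g.comp_continuousOn (continuousOn_fst (s := S ×ˢ Icc (0 : ℝ) 1)))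
  have cF := (p.continuous_F.comp_continuousOn (continuousOn_fst (s := S ×ˢ Icc (0 : ℝ) 1)))
  exact ((d₂.sub d₁).mul (cs.div cP fun z hz => hΨ z.1 hz.1 z.2 hz.2)).add
    ((c₂.sub c₁).mul (((cm.mul cP).sub (cs.mul (((cf.mul cs).add (cg.const_mul 2)).add
      (((cs.const_mul 2).add cF).mul cm)))).div (cP.pow 2)
      fun z hz => pow_ne_zero 2 (hΨ z.1 hz.1 z.2 hz.2)))

lemma IsArc.continuousOn_stripInt {Y₁ Y₂ : ℝ → ℝ} {q r : ℝ} (h₁ : p.IsArc Y₁ q r)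
    (h₂ : p.IsArc Y₂ q r)
    (hΨ : ∀ x ∈ Icc q r, ∀ t ∈ Icc (0 : ℝ) 1, p.Psi x (Y₁ x + (Y₂ x - Y₁ x) * t) ≠ 0) :
    ContinuousOn (fun x => p.stripInt (Y₁ x) (Y₂ x) x) (Icc q r) := by
  simp only [stripInt_eq]
  exact continuousOn_integral_of_continuousOn_prod zero_le_one
    (continuousOn_strip h₁.continuousOn h₂.continuousOn hΨ)

lemma IsArc.continuousOn_slope {Y : ℝ → ℝ} {q r l u : ℝ} (h : p.IsArc Y q r)
    (hsub : Icc l u ⊆ Ioo q r) :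
    ContinuousOn (fun x => (-p.g x - p.f x * Y x) / Y x) (Icc l u) := by
  have c := h.continuousOn.mono (hsub.trans Ioo_subset_Icc_self)
  exact ((p.continuous_g.continuousOn.neg).sub (p.continuous_f.continuousOn.mul c)).div c
    fun x hx => h.ne_zero x (hsub hx)

/-- The Dulac–Cherkas identity on a strip between two arcs. -/
lemma IsArc.exists_hasDerivAt_stripInt {Y₁ Y₂ : ℝ → ℝ} {q r x : ℝ} (h₁ : p.IsArc Y₁ q r)
    (h₂ : p.IsArc Y₂ q r)
    (hΨ : ∀ x ∈ Icc q r, ∀ t ∈ Icc (0 : ℝ) 1, p.Psi x (Y₁ x + (Y₂ x - Y₁ x) * t) ≠ 0)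
    (hx : x ∈ Ioo q r) :
    ∃ I > 0, HasDerivAt (fun x => p.stripInt (Y₁ x) (Y₂ x) x)
      (-((Y₂ x - Y₁ x) * p.Phi x * I)) x := by
  have hx' := Ioo_subset_Icc_self hx
  set l := (q + x) / 2
  set u := (x + r) / 2
  have hsub : Icc l u ⊆ Ioo q r := fun v hv => by
    have := hx.1
    have := hx.2
    have := hv.1
    have := hv.2
    simp only [l, u] at *
    constructor <;> linarith
  have hsub' := hsub.trans Ioo_subset_Icc_self
  have hxl : x ∈ Ioo l u := by
    have := hx.1
    have := hx.2
    constructor <;> simp only [l, u] <;> linarith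
  set m₁ : ℝ → ℝ := fun x => (-p.g x - p.f x * Y₁ x) / Y₁ x
  set m₂ : ℝ → ℝ := fun x => (-p.g x - p.f x * Y₂ x) / Y₂ x
  have cD := continuousOn_stripDeriv (h₁.continuousOn.mono hsub') (h₂.continuousOn.mono hsub')
    (h₁.continuousOn_slope hsub) (h₂.continuousOn_slope hsub)
    (fun x hx t ht => hΨ x (hsub' hx) t ht)
  have d := hasDerivAt_integral_of_continuousOn_prod zero_le_one hxl
    (continuousOn_strip (h₁.continuousOn.mono hsub') (h₂.continuousOn.mono hsub')
      (fun x hx t ht => hΨ x (hsub' hx) t ht)) cD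
    (fun x hx t ht => p.hasDerivAt_strip (h₁.hasDerivAt x (hsub hx)) (h₂.hasDerivAt x (hsub hx))
      (hΨ x (hsub' hx) t ht))
  simp only [← stripInt_eq] at d
  have iD := intervalIntegrable_of_continuousOn_prod zero_le_one (Ioo_subset_Icc_self hxl) cD
  have cP : ContinuousOn (fun t => p.Psi x (Y₁ x + (Y₂ x - Y₁ x) * t)) (Icc 0 1) := by
    have := p.continuous_Psi.comp (f := fun t => (x, Y₁ x + (Y₂ x - Y₁ x) * t)) (by fun_prop)
    exact this.continuousOn
  have cI : ContinuousOn (fun t => 1 / p.Psi x (Y₁ x + (Y₂ x - Y₁ x) * t) ^ 2) (Icc 0 1) :=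
    continuousOn_const.div (cP.pow 2) fun t ht => pow_ne_zero 2 (hΨ x hx' t ht)
  have iI : IntervalIntegrable (fun t => 1 / p.Psi x (Y₁ x + (Y₂ x - Y₁ x) * t) ^ 2)
      MeasureTheory.volume 0 1 := by
    apply ContinuousOn.intervalIntegrable
    rwa [uIcc_of_le zero_le_one]
  refine ⟨∫ t in (0 : ℝ)..1, 1 / p.Psi x (Y₁ x + (Y₂ x - Y₁ x) * t) ^ 2, ?_, ?_⟩
  · refine intervalIntegral.intervalIntegral_pos_of_pos_on iI (fun t ht => ?_) zero_lt_one
    have := hΨ x hx' t (Ioo_subset_Icc_self ht)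
    positivity
  · refine d.congr_deriv ?_
    have iI' := iI.const_mul ((Y₂ x - Y₁ x) * p.Phi x)
    have ftc := intervalIntegral.integral_eq_sub_of_hasDerivAt (a := 0) (b := 1)
      (fun t ht => p.hasDerivAt_strip_boundary (m₁ := m₁ x) (m₂ := m₂ x)
        (hΨ x hx' t (by rwa [uIcc_of_le zero_le_one] at ht)))
      ((iD.add iI').congr (fun t _ => by ring))
    have e : (∫ t in (0 : ℝ)..1, p.stripDeriv x (Y₁ x) (Y₂ x) (m₁ x) (m₂ x) t +
        (Y₂ x - Y₁ x) * (p.Phi x / p.Psi x (Y₁ x + (Y₂ x - Y₁ x) * t) ^ 2)) =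
        (∫ t in (0 : ℝ)..1, p.stripDeriv x (Y₁ x) (Y₂ x) (m₁ x) (m₂ x) t) +
        (Y₂ x - Y₁ x) * p.Phi x *
          ∫ t in (0 : ℝ)..1, 1 / p.Psi x (Y₁ x + (Y₂ x - Y₁ x) * t) ^ 2 := by
      rw [← intervalIntegral.integral_const_mul, ← intervalIntegral.integral_add iD iI']
      apply intervalIntegral.integral_congr
      intro t _
      simp only
      ring
    rw [e] at ftc
    have n₁ := h₁.ne_zero x hx
    have n₂ := h₂.ne_zero x hx
    have z : ∀ y : ℝ, y ≠ 0 → y / p.Psi x y * ((-p.g x - p.f x * y) / y)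
        - (-p.g x - p.f x * y) / p.Psi x y = 0 := by
      intro y hy
      rw [div_mul_div_comm, mul_comm y, mul_div_mul_right _ _ hy, sub_self]
    have b1 : Y₁ x + (Y₂ x - Y₁ x) * 1 = Y₂ x := by ring
    have b0 : Y₁ x + (Y₂ x - Y₁ x) * 0 = Y₁ x := by ring
    have b3 : m₁ x + (m₂ x - m₁ x) * 1 = m₂ x := by ring
    have b4 : m₁ x + (m₂ x - m₁ x) * 0 = m₁ x := by ring
    rw [b1, b0, b3, b4, z _ n₁, z _ n₂] at ftc
    linarith

end Params

/-- A continuous function on `[q, r]` whose derivative is nonpositive inside, and negative off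
`x² = B`, is strictly smaller at the right endpoint. -/
theorem lt_of_hasDerivAt_nonpos_of_neg {T T' : ℝ → ℝ} {q r B : ℝ} (hqr : q < r)
    (cT : ContinuousOn T (Icc q r)) (dT : ∀ x ∈ Ioo q r, HasDerivAt T (T' x) x)
    (h0 : ∀ x ∈ Ioo q r, T' x ≤ 0) (h1 : ∀ x ∈ Ioo q r, x ^ 2 ≠ B → T' x < 0) : T r < T q := by
  have anti : AntitoneOn T (Icc q r) := by
    refine antitoneOn_of_deriv_nonpos (convex_Icc q r) cT ?_ ?_
    · intro x hx
      rw [interior_Icc] at hx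
      exact (dT x hx).differentiableAt.differentiableWithinAt
    · intro x hx
      rw [interior_Icc] at hx
      rw [(dT x hx).deriv]
      exact h0 x hx
  have mq := left_mem_Icc.2 hqr.le
  have mr := right_mem_Icc.2 hqr.le
  refine lt_of_le_of_ne (anti mq mr hqr.le) fun he => ?_
  have hc : ∀ x ∈ Icc q r, T x = T q := fun x hx =>
    le_antisymm (anti mq hx hx.1) (he ▸ anti hx mr hx.2)
  have hz : ∀ x ∈ Ioo q r, x ^ 2 = B := by
    intro x hx
    by_contra hne
    have e : T =ᶠ[𝓝 x] fun _ => T q := by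
      filter_upwards [Icc_mem_nhds hx.1 hx.2] with v hv using hc v hv
    have := (dT x hx).unique ((hasDerivAt_const x (T q)).congr_of_eventuallyEq e)
    linarith [h1 x hx hne]
  have a1 := hz ((3 * q + r) / 4) ⟨by linarith, by linarith⟩
  have a2 := hz ((2 * q + 2 * r) / 4) ⟨by linarith, by linarith⟩
  have a3 := hz ((q + 3 * r) / 4) ⟨by linarith, by linarith⟩
  nlinarith [mul_pos (sub_pos.2 hqr) (sub_pos.2 hqr)]

end

section Zeros

theorem HasDerivAt.eventually_pos_right {y : ℝ → ℝ} {d t : ℝ} (h : HasDerivAt y d t)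
    (h0 : y t = 0) (hd : 0 < d) : ∀ᶠ u in 𝓝[>] t, 0 < y u := by
  have h1 := hasDerivAt_iff_tendsto_slope.1 h
  have h2 : ∀ᶠ u in 𝓝[>] t, 0 < slope y t u :=
    (h1.mono_left (nhdsWithin_mono t fun u hu => ne_of_gt hu)).eventually_const_lt hd
  filter_upwards [h2, self_mem_nhdsWithin] with u hu hut
  rw [slope_def_field, h0, sub_zero] at hu
  have : (0 : ℝ) < u - t := sub_pos.2 hut
  exact (div_pos_iff_of_pos_right this).1 hu

theorem HasDerivAt.eventually_neg_left {y : ℝ → ℝ} {d t : ℝ} (h : HasDerivAt y d t)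
    (h0 : y t = 0) (hd : 0 < d) : ∀ᶠ u in 𝓝[<] t, y u < 0 := by
  have h1 := hasDerivAt_iff_tendsto_slope.1 h
  have h2 : ∀ᶠ u in 𝓝[<] t, 0 < slope y t u :=
    (h1.mono_left (nhdsWithin_mono t fun u hu => ne_of_lt hu)).eventually_const_lt hd
  filter_upwards [h2, self_mem_nhdsWithin] with u hu hut
  rw [slope_def_field, h0, sub_zero] at hu
  have : u - t < 0 := sub_neg.2 hut
  by_contra! hn
  linarith [div_nonpos_of_nonneg_of_nonpos hn this.le]

theorem exists_first_zero {y : ℝ → ℝ} {a b : ℝ} (hab : a < b) (c : ContinuousOn y (Icc a b))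
    (hpos : ∀ᶠ t in 𝓝[>] a, 0 < y t) (hb : y b ≤ 0) :
    ∃ t ∈ Ioc a b, y t = 0 ∧ ∀ u ∈ Ioo a t, 0 < y u := by
  obtain ⟨a', ha', hpos'⟩ := mem_nhdsGT_iff_exists_Ioo_subset.1 hpos
  have ha'' : a < a' := ha'
  set a₁ := min ((a + a') / 2) b
  have h1 : a < a₁ := lt_min (by linarith) hab
  have h1' : a₁ ≤ b := min_le_right _ _
  have hp : ∀ t, a < t → t ≤ a₁ → 0 < y t := fun t h h' =>
    hpos' ⟨h, (h'.trans (min_le_left _ _)).trans_lt (by linarith)⟩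
  have c' : ContinuousOn y (Icc a₁ b) := c.mono (Icc_subset_Icc_left h1.le)
  have hS : IsCompact (Icc a₁ b ∩ y ⁻¹' Iic 0) :=
    isCompact_Icc.of_isClosed_subset (c'.preimage_isClosed_of_isClosed isClosed_Icc isClosed_Iic)
      inter_subset_left
  obtain ⟨t, ⟨ht, hyt⟩, hleast⟩ := hS.exists_isLeast ⟨b, ⟨h1', le_rfl⟩, hb⟩
  have hbefore : ∀ u ∈ Ioo a t, 0 < y u := by
    intro u hu
    rcases le_total u a₁ with h | h
    · exact hp u hu.1 h
    · by_contra! hn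
      exact absurd (hleast ⟨⟨h, hu.2.le.trans ht.2⟩, hn⟩) (not_le.2 hu.2)
  have hat : a < t := h1.trans_le ht.1
  refine ⟨t, ⟨hat, ht.2⟩, le_antisymm hyt ?_, hbefore⟩
  have ct : ContinuousWithinAt y (Ioo a t) t :=
    (c t ⟨hat.le, ht.2⟩).mono fun u hu => ⟨hu.1.le, hu.2.le.trans ht.2⟩
  have hcl : t ∈ closure (Ioo a t) := by rw [closure_Ioo hat.ne]; exact ⟨hat.le, le_rfl⟩
  have := ct.mem_closure hcl (t := Ici 0) fun u hu => (hbefore u hu).le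
  simpa using this

end Zeros

noncomputable section

namespace Params

variable {p : Params} {γ : ℝ → ℝ × ℝ} {a b : ℝ}

lemma Psi_segment (p : Params) (x y₁ y₂ t : ℝ) : p.Psi x (y₁ + (y₂ - y₁) * t) =
    (1 - t) * p.Psi x y₁ + t * p.Psi x y₂ - t * (1 - t) * (y₂ - y₁) ^ 2 := by
  unfold Psi; ring

lemma Psi_segment_neg {x y₁ y₂ t : ℝ} (h₁ : p.Psi x y₁ < 0) (h₂ : p.Psi x y₂ < 0)
    (ht : t ∈ Icc (0 : ℝ) 1) : p.Psi x (y₁ + (y₂ - y₁) * t) < 0 := by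
  rw [Psi_segment]
  have h3 : 0 ≤ 1 - t := by linarith [ht.2]
  have := mul_nonneg (mul_nonneg ht.1 h3) (sq_nonneg (y₂ - y₁))
  rcases ht.1.eq_or_lt with h | h
  · rw [← h]; linarith
  · nlinarith [mul_neg_of_pos_of_neg h h₂, mul_nonpos_of_nonneg_of_nonpos h3 h₁.le]

/-- Where the velocity reaches zero from above, off the zeros of `g`, one has `0 < g`. -/
lemma IsSolOn.snd_deriv_neg {s : Set ℝ} (h : p.IsSolOn γ s) {t : ℝ} (ht : t ∈ s) (hab : a < t)
    (hpos : ∀ u ∈ Ioo a t, 0 < (γ u).2) (hy : (γ t).2 = 0) (hg : p.g (γ t).1 ≠ 0) :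
    0 < p.g (γ t).1 := by
  by_contra! hn
  have hg' : p.g (γ t).1 < 0 := lt_of_le_of_ne hn hg
  have d := h.snd ht
  have := d.eventually_neg_left hy (by rw [hy]; linarith)
  obtain ⟨u, hu, hu'⟩ := (this.and (Ioo_mem_nhdsLT hab)).exists
  linarith [hpos u hu']

/-- Arcs issued from a zero of the velocity with `g < 0` at a periodic solution. -/
lemma IsSolOn.exists_right_arc (h : p.IsSolOn γ univ) (hn : ¬ ∀ t s, γ t = γ s) {T : ℝ}
    (hT : 0 < T) (hper : Function.Periodic γ T) {t₀ : ℝ} (hy : (γ t₀).2 = 0)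
    (hg : p.g (γ t₀).1 < 0) :
    ∃ t₁ > t₀, (γ t₁).2 = 0 ∧ 0 < p.g (γ t₁).1 ∧ ∀ u ∈ Ioo t₀ t₁, 0 < (γ u).2 := by
  have hpos := (h.snd (mem_univ t₀)).eventually_pos_right hy (by rw [hy]; linarith)
  obtain ⟨t₁, ht₁, hy₁, hp₁⟩ := exists_first_zero (y := fun t => (γ t).2) (b := t₀ + T)
    (by linarith) (fun t _ => (h.snd (mem_univ t)).continuousAt.continuousWithinAt) hpos
    (by simp only [hper t₀, hy]; exact le_rfl)
  exact ⟨t₁, ht₁.1, hy₁, h.snd_deriv_neg (mem_univ t₁) ht₁.1 hp₁ hy₁ (h.g_ne_zero hn hy₁), hp₁⟩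

lemma g_neg_arg (p : Params) (x : ℝ) : p.g (-x) = -p.g x := by unfold g; ring

lemma IsSolOn.exists_left_arc (h : p.IsSolOn γ univ) (hn : ¬ ∀ t s, γ t = γ s) {T : ℝ}
    (hT : 0 < T) (hper : Function.Periodic γ T) {t₀ : ℝ} (hy : (γ t₀).2 = 0)
    (hg : 0 < p.g (γ t₀).1) :
    ∃ t₁ > t₀, (γ t₁).2 = 0 ∧ p.g (γ t₁).1 < 0 ∧ ∀ u ∈ Ioo t₀ t₁, (γ u).2 < 0 := by
  obtain ⟨t₁, h1, h2, h3, h4⟩ := h.neg.exists_right_arc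
    (fun h' => hn fun t s => by simpa using h' t s) hT
    (fun t => by simp only [hper t]) (t₀ := t₀) (by simp [hy]) (by simpa [g_neg_arg] using hg)
  refine ⟨t₁, h1, by simpa using h2, by simpa [g_neg_arg] using h3, fun u hu => ?_⟩
  have := h4 u hu
  simpa using this

/-- A nonconstant periodic solution has a leftmost point, where `g < 0`. -/
lemma IsSolOn.exists_isMin (h : p.IsSolOn γ univ) (hn : ¬ ∀ t s, γ t = γ s) {T : ℝ}
    (hT : 0 < T) (hper : Function.Periodic γ T) :
    ∃ t₀, (∀ t, (γ t₀).1 ≤ (γ t).1) ∧ (γ t₀).2 = 0 ∧ p.g (γ t₀).1 < 0 := by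
  have c : Continuous fun t => (γ t).1 :=
    continuous_iff_continuousAt.2 fun t => (h.fst (mem_univ t)).continuousAt
  obtain ⟨t₀, -, hmin⟩ := (isCompact_Icc (a := 0) (b := T)).exists_isMinOn
    (nonempty_Icc.2 hT.le) c.continuousOn
  have hmin' : ∀ t, (γ t₀).1 ≤ (γ t).1 := by
    intro t
    obtain ⟨u, hu, he⟩ := hper.exists_mem_Ico₀ hT t
    rw [he]
    exact hmin ⟨hu.1, hu.2.le⟩
  have hy : (γ t₀).2 = 0 :=
    IsLocalMin.hasDerivAt_eq_zero (Eventually.of_forall hmin') (h.fst (mem_univ t₀))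
  refine ⟨t₀, hmin', hy, ?_⟩
  by_contra! hg
  have hg' : 0 < p.g (γ t₀).1 := lt_of_le_of_ne hg (h.g_ne_zero hn hy).symm
  obtain ⟨t₁, h1, h2, h3, h4⟩ := h.exists_left_arc hn hT hper hy hg'
  have := ((h.mono (subset_univ _)).exists_lower_arc h1 h4).1 (left_mem_Icc.2 h1.le)
    (right_mem_Icc.2 h1.le) h1
  exact absurd (hmin' t₁) (not_le.2 this)

/-- Nonconstant periodic solutions lie in `Ψ > 0`. -/
lemma IsSolOn.Psi_pos_of_periodic (h : p.IsSolOn γ univ) (hn : ¬ ∀ t s, γ t = γ s) {T : ℝ}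
    (hT : 0 < T) (hper : Function.Periodic γ T) (t : ℝ) : 0 < p.Psi (γ t).1 (γ t).2 := by
  rcases h.periodic_dichotomy hT hper with hP | hP
  · exact hP t
  exfalso
  obtain ⟨t₀, hmin, hy₀, hg₀⟩ := h.exists_isMin hn hT hper
  obtain ⟨t₁, h01, hy₁, hg₁, hp₁⟩ := h.exists_right_arc hn hT hper hy₀ hg₀
  obtain ⟨t₂, h12, hy₂, hg₂, hp₂⟩ := h.exists_left_arc hn hT hper hy₁ hg₁
  obtain ⟨-, su, Y, aY, eY, pY⟩ := (h.mono (subset_univ _)).exists_upper_arc h01 hp₁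
  obtain ⟨mz, sl, Z, aZ, eZ, pZ⟩ := (h.mono (subset_univ _)).exists_lower_arc h12 hp₂
  have hlt : (γ t₂).1 < (γ t₁).1 := mz (left_mem_Icc.2 h12.le) (right_mem_Icc.2 h12.le) h12
  have aY' := aY.mono (hmin t₂) le_rfl
  have PY : ∀ x ∈ Icc (γ t₂).1 (γ t₁).1, p.Psi x (Y x) < 0 := by
    intro x hx
    obtain ⟨t, ht, rfl⟩ := su x ⟨(hmin t₂).trans hx.1, hx.2⟩
    rw [eY t ht]
    exact hP t
  have PZ : ∀ x ∈ Icc (γ t₂).1 (γ t₁).1, p.Psi x (Z x) < 0 := by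
    intro x hx
    obtain ⟨t, ht, rfl⟩ := sl x hx
    rw [eZ t ht]
    exact hP t
  have hΨ : ∀ x ∈ Icc (γ t₂).1 (γ t₁).1, ∀ t ∈ Icc (0 : ℝ) 1,
      p.Psi x (Z x + (Y x - Z x) * t) ≠ 0 := fun x hx t ht =>
    (Psi_segment_neg (PZ x hx) (PY x hx) ht).ne
  have key : ∀ x ∈ Ioo (γ t₂).1 (γ t₁).1, ∃ I > 0, HasDerivAt (fun x => p.stripInt (Z x) (Y x) x)
      (-((Y x - Z x) * p.Phi x * I)) x := fun x hx => aZ.exists_hasDerivAt_stripInt aY' hΨ hx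
  choose! I hI dI using key
  have dec := lt_of_hasDerivAt_nonpos_of_neg (B := p.B) hlt (aZ.continuousOn_stripInt aY' hΨ) dI
    (fun x hx => by
      have h1 : 0 < Y x - Z x := by
        linarith [pY x ⟨(hmin t₂).trans_lt hx.1, hx.2⟩, pZ x hx]
      have h2 := p.Phi_nonneg x
      have h3 := hI x hx
      have : 0 ≤ (Y x - Z x) * p.Phi x * I x := by positivity
      linarith)
    (fun x hx hB => by
      have h1 : 0 < Y x - Z x := by
        linarith [pY x ⟨(hmin t₂).trans_lt hx.1, hx.2⟩, pZ x hx]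
      have h2 := p.Phi_pos hB
      have h3 := hI x hx
      have : 0 < (Y x - Z x) * p.Phi x * I x := by positivity
      linarith)
  have e1 : Z (γ t₁).1 = 0 := by rw [eZ t₁ (left_mem_Icc.2 h12.le), hy₁]
  have e2 : Y (γ t₁).1 = 0 := by rw [eY t₁ (right_mem_Icc.2 h01.le), hy₁]
  have e3 : Z (γ t₂).1 = 0 := by rw [eZ t₂ (right_mem_Icc.2 h12.le), hy₂]
  simp only [e1, e2, e3] at dec
  have hx2 : (γ t₂).1 ∈ Icc (γ t₂).1 (γ t₁).1 := left_mem_Icc.2 hlt.le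
  have Ypos : 0 ≤ Y (γ t₂).1 := by
    rcases (hmin t₂).eq_or_lt with he | he
    · rw [← he, eY t₀ (left_mem_Icc.2 h01.le), hy₀]
    · exact (pY _ ⟨he, hlt⟩).le
  have le : p.stripInt 0 (Y (γ t₂).1) (γ t₂).1 ≤ 0 := by
    rw [stripInt_eq, ← neg_nonneg, ← intervalIntegral.integral_neg]
    apply intervalIntegral.integral_nonneg zero_le_one
    intro t ht
    have n := Psi_segment_neg (PZ _ hx2) (PY _ hx2) ht
    rw [e3] at n
    have ht0 : 0 ≤ t := ht.1
    rw [sub_zero, zero_add] at *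
    rw [neg_nonneg]
    exact mul_nonpos_of_nonneg_of_nonpos Ypos
      (div_nonpos_of_nonneg_of_nonpos (mul_nonneg Ypos ht0) n.le)
  have z : p.stripInt 0 0 (γ t₁).1 = 0 := by simp [stripInt]
  linarith

end Params

end

noncomputable section

namespace Params

variable {p : Params} {γ γ₁ γ₂ : ℝ → ℝ × ℝ}

/-- A solution on `[0, τ]` joining `(0, s)` to `(0, -r)` in the half plane `0 < x`. -/
structure IsHalfOrbit (p : Params) (γ : ℝ → ℝ × ℝ) (τ s r : ℝ) : Prop where
  sol : p.IsSolOn γ (Icc 0 τ)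
  time_pos : 0 < τ
  start : γ 0 = (0, s)
  finish : γ τ = (0, -r)
  pos : ∀ t ∈ Ioo 0 τ, 0 < (γ t).1
  start_pos : 0 < s
  le_start : p.c ≤ s ^ 2
  finish_pos : 0 < r

/-- The upper arc `Y` and the lower arc `Z` of a half orbit, which meet at `(A, 0)`. -/
structure IsHalfLoop (p : Params) (A : ℝ) (Y Z : ℝ → ℝ) : Prop where
  one_lt : 1 < A
  upper : p.IsArc Y 0 A
  lower : p.IsArc Z 0 A
  upper_end : Y A = 0
  lower_end : Z A = 0
  upper_pos : ∀ x ∈ Ico 0 A, 0 < Y x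
  lower_neg : ∀ x ∈ Ico 0 A, Z x < 0
  Psi_upper : ∀ x ∈ Ioc 0 A, 0 < p.Psi x (Y x)
  Psi_lower : ∀ x ∈ Icc 0 A, 0 < p.Psi x (Z x)

lemma g_pos {x : ℝ} (hx : 1 < x) : 0 < p.g x := by
  have := p.ha
  have : 0 < x ^ 2 - 1 := by nlinarith
  have : 0 < x := by linarith
  unfold g; positivity

/-- After a zero the velocity stays negative as long as all its zeros have `0 < g`. -/
lemma IsSolOn.snd_neg_of_zero {a b : ℝ} (h : p.IsSolOn γ (Icc a b)) (hab : a < b)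
    (hy : (γ a).2 = 0) (hg : ∀ t ∈ Icc a b, (γ t).2 = 0 → 0 < p.g (γ t).1) : (γ b).2 < 0 := by
  by_contra! hn
  have ha := left_mem_Icc.2 hab.le
  have hneg : ∀ᶠ t in 𝓝[>] a, 0 < -(γ t).2 :=
    (h.snd ha).neg.eventually_pos_right (by simp [hy]) (by rw [hy]; linarith [hg a ha hy])
  obtain ⟨t, ht, hyt, hp⟩ := exists_first_zero (y := fun t => -(γ t).2) hab
    (fun t ht => (h.snd ht).continuousAt.neg.continuousWithinAt) hneg (by simpa using hn)
  have ht' := Ioc_subset_Icc_self ht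
  have hyt' : (γ t).2 = 0 := by simpa using hyt
  have hx := hg t ht' hyt'
  have := h.neg.snd_deriv_neg ht' ht.1 (fun v hv => by simpa using hp v hv) (by simp [hyt'])
    (by simpa [g_neg_arg] using hx.ne')
  simp only [Prod.fst_neg, g_neg_arg] at this
  linarith

namespace IsHalfOrbit

variable {τ s r τ₁ s₁ r₁ τ₂ s₂ r₂ : ℝ}

lemma Psi_pos (h : p.IsHalfOrbit γ τ s r) {t : ℝ} (ht : t ∈ Ioc 0 τ) :
    0 < p.Psi (γ t).1 (γ t).2 := by
  refine (h.sol.mono (Icc_subset_Icc_right ht.2)).Psi_pos ht.1 ?_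
  rw [h.start, Psi_zero_left]
  linarith [h.le_start]

lemma one_lt_of_snd_eq_zero (h : p.IsHalfOrbit γ τ s r) {t : ℝ} (ht : t ∈ Ioc 0 τ)
    (hy : (γ t).2 = 0) : 1 < (γ t).1 := by
  have h1 := h.Psi_pos ht
  have hne : t ≠ τ := by
    rintro rfl
    rw [h.finish] at hy
    linarith [h.finish_pos, show -r = 0 from hy]
  have h2 := h.pos t ⟨ht.1, lt_of_le_of_ne ht.2 hne⟩
  rw [hy] at h1
  by_contra! hn
  linarith [p.Psi_neg_of_sq_le (x := (γ t).1) (by nlinarith)]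

/-- A half orbit crosses the `x`-axis exactly once. -/
lemma exists_split (h : p.IsHalfOrbit γ τ s r) : ∃ t₁ ∈ Ioo 0 τ, (γ t₁).2 = 0 ∧
    (∀ u ∈ Ioo 0 t₁, 0 < (γ u).2) ∧ ∀ u ∈ Ioo t₁ τ, (γ u).2 < 0 := by
  have c : ContinuousOn (fun t => (γ t).2) (Icc 0 τ) :=
    fun t ht => (h.sol.snd ht).continuousAt.continuousWithinAt
  have h0 : (0 : ℝ) ∈ Icc 0 τ := left_mem_Icc.2 h.time_pos.le
  have hpos : ∀ᶠ t in 𝓝[>] (0 : ℝ), 0 < (γ t).2 :=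
    ((h.sol.snd h0).continuousAt.eventually_const_lt
      (by simpa [h.start] using h.start_pos)).filter_mono nhdsWithin_le_nhds
  obtain ⟨t₁, ht₁, hy₁, hp₁⟩ := exists_first_zero h.time_pos c hpos
    (by rw [h.finish]; linarith [h.finish_pos])
  have hne : t₁ ≠ τ := by
    rintro rfl
    rw [h.finish] at hy₁
    linarith [h.finish_pos, show -r = 0 from hy₁]
  have hlt : t₁ < τ := lt_of_le_of_ne ht₁.2 hne
  refine ⟨t₁, ⟨ht₁.1, hlt⟩, hy₁, hp₁, fun u hu => ?_⟩
  exact (h.sol.mono (Icc_subset_Icc ht₁.1.le hu.2.le)).snd_neg_of_zero hu.1 hy₁ fun t ht hy =>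
    p.g_pos (h.one_lt_of_snd_eq_zero ⟨ht₁.1.trans_le ht.1, ht.2.trans hu.2.le⟩ hy)

lemma exists_isHalfLoop (h : p.IsHalfOrbit γ τ s r) : ∃ A Y Z, p.IsHalfLoop A Y Z ∧
    Y 0 = s ∧ Z 0 = -r ∧ (∀ x ∈ Icc 0 A, ∃ t ∈ Icc 0 τ, γ t = (x, Y x)) ∧
    ∀ x ∈ Icc 0 A, ∃ t ∈ Icc 0 τ, γ t = (x, Z x) := by
  obtain ⟨t₁, ht₁, hy₁, hp₁, hn₁⟩ := h.exists_split
  have su : Icc 0 t₁ ⊆ Icc 0 τ := Icc_subset_Icc_right ht₁.2.le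
  have sl : Icc t₁ τ ⊆ Icc 0 τ := Icc_subset_Icc_left ht₁.1.le
  obtain ⟨-, iY, Y, aY, eY, pY⟩ := (h.sol.mono su).exists_upper_arc ht₁.1 hp₁
  obtain ⟨-, iZ, Z, aZ, eZ, pZ⟩ := (h.sol.mono sl).exists_lower_arc ht₁.2 hn₁
  have h0 : (γ 0).1 = 0 := by rw [h.start]
  have hτ : (γ τ).1 = 0 := by rw [h.finish]
  rw [h0] at iY aY pY
  rw [hτ] at iZ aZ pZ
  have hA : 1 < (γ t₁).1 := h.one_lt_of_snd_eq_zero ⟨ht₁.1, ht₁.2.le⟩ hy₁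
  have Y0 : Y 0 = s := by
    have := eY 0 (left_mem_Icc.2 ht₁.1.le)
    rwa [h.start] at this
  have Z0 : Z 0 = -r := by
    have := eZ τ (right_mem_Icc.2 ht₁.2.le)
    rwa [h.finish] at this
  refine ⟨(γ t₁).1, Y, Z, ⟨hA, aY, aZ, ?_, ?_, ?_, ?_, ?_, ?_⟩, Y0, Z0, ?_, ?_⟩
  · rw [eY t₁ (right_mem_Icc.2 ht₁.1.le), hy₁]
  · rw [eZ t₁ (left_mem_Icc.2 ht₁.2.le), hy₁]
  · intro x hx
    rcases hx.1.eq_or_lt with rfl | hx0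
    · rw [Y0]; exact h.start_pos
    · exact pY x ⟨hx0, hx.2⟩
  · intro x hx
    rcases hx.1.eq_or_lt with rfl | hx0
    · rw [Z0]; linarith [h.finish_pos]
    · exact pZ x ⟨hx0, hx.2⟩
  · intro x hx
    obtain ⟨t, ht, rfl⟩ := iY x ⟨hx.1.le, hx.2⟩
    have : t ≠ 0 := by rintro rfl; linarith [hx.1]
    rw [eY t ht]
    exact h.Psi_pos ⟨lt_of_le_of_ne ht.1 this.symm, (su ht).2⟩
  · intro x hx
    obtain ⟨t, ht, rfl⟩ := iZ x hx
    rw [eZ t ht]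
    exact h.Psi_pos ⟨ht₁.1.trans_le ht.1, ht.2⟩
  · intro x hx
    obtain ⟨t, ht, rfl⟩ := iY x hx
    exact ⟨t, su ht, by rw [eY t ht]⟩
  · intro x hx
    obtain ⟨t, ht, rfl⟩ := iZ x hx
    exact ⟨t, sl ht, by rw [eZ t ht]⟩

/-- Two half orbits which meet have the same starting point. -/
lemma eq_of_meet (h₁ : p.IsHalfOrbit γ₁ τ₁ s₁ r₁) (h₂ : p.IsHalfOrbit γ₂ τ₂ s₂ r₂) {t u : ℝ}
    (ht : t ∈ Icc 0 τ₁) (hu : u ∈ Icc 0 τ₂) (htu : t ≤ u) (he : γ₁ t = γ₂ u) : s₁ = s₂ := by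
  have hη : p.IsSolOn (fun v => γ₂ (v + (u - t))) (Icc 0 t) :=
    (h₂.sol.comp_add_const (u - t)).mono fun v hv => ⟨by linarith [hv.1], by linarith [hv.2, hu.2]⟩
  have := (h₁.sol.mono (Icc_subset_Icc_right ht.2)).eqOn hη (right_mem_Icc.2 ht.1)
    (by simpa using he) (left_mem_Icc.2 ht.1)
  simp only [zero_add, h₁.start] at this
  by_cases h0 : u - t = 0
  · rw [h0, h₂.start] at this
    exact congrArg Prod.snd this
  · exfalso
    have h0' : 0 < u - t := lt_of_le_of_ne (sub_nonneg.2 htu) (Ne.symm h0)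
    have hlt : u - t ≤ τ₂ := by linarith [ht.1, hu.2]
    rcases hlt.eq_or_lt with h | h
    · rw [h, h₂.finish] at this
      have := congrArg Prod.snd this
      simp only at this
      linarith [h₁.start_pos, h₂.finish_pos]
    · have h' := h₂.pos _ ⟨h0', h⟩
      rw [← this] at h'
      exact lt_irrefl _ h'

lemma ne_of_ne (h₁ : p.IsHalfOrbit γ₁ τ₁ s₁ r₁) (h₂ : p.IsHalfOrbit γ₂ τ₂ s₂ r₂) (hs : s₁ ≠ s₂)
    {t u : ℝ} (ht : t ∈ Icc 0 τ₁) (hu : u ∈ Icc 0 τ₂) : γ₁ t ≠ γ₂ u := by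
  intro he
  rcases le_total t u with h | h
  · exact hs (h₁.eq_of_meet h₂ ht hu h he)
  · exact hs (h₂.eq_of_meet h₁ hu ht h he.symm).symm

end IsHalfOrbit

/-- Continuous functions which do not meet are ordered as at the left endpoint. -/
theorem _root_.lt_of_continuousOn_of_ne {f g : ℝ → ℝ} {a b : ℝ} (hf : ContinuousOn f (Icc a b))
    (hg : ContinuousOn g (Icc a b)) (hne : ∀ x ∈ Icc a b, f x ≠ g x) {x₀ x : ℝ}
    (hx₀ : x₀ ∈ Icc a b) (h₀ : f x₀ < g x₀) (hx : x ∈ Icc a b) : f x < g x := by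
  by_contra! hn
  obtain ⟨z, hz, he⟩ := isPreconnected_Icc.intermediate_value₂ hx₀ hx hf hg h₀.le hn
  exact hne z hz he

/-- Half orbits are nested. -/
lemma IsHalfOrbit.nested {τ₁ s₁ r₁ τ₂ s₂ r₂ : ℝ} (h₁ : p.IsHalfOrbit γ₁ τ₁ s₁ r₁)
    (h₂ : p.IsHalfOrbit γ₂ τ₂ s₂ r₂) (hs : s₁ < s₂) :
    ∃ A₁ Y₁ Z₁ A₂ Y₂ Z₂, p.IsHalfLoop A₁ Y₁ Z₁ ∧ p.IsHalfLoop A₂ Y₂ Z₂ ∧ A₁ < A₂ ∧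
      (∀ x ∈ Icc 0 A₁, Y₁ x < Y₂ x ∧ Z₂ x < Z₁ x) ∧
      Y₁ 0 = s₁ ∧ Z₁ 0 = -r₁ ∧ Y₂ 0 = s₂ ∧ Z₂ 0 = -r₂ := by
  obtain ⟨A₁, Y₁, Z₁, l₁, eY₁, eZ₁, iY₁, iZ₁⟩ := h₁.exists_isHalfLoop
  obtain ⟨A₂, Y₂, Z₂, l₂, eY₂, eZ₂, iY₂, iZ₂⟩ := h₂.exists_isHalfLoop
  have p₁ := l₁.one_lt
  have p₂ := l₂.one_lt
  have neY : ∀ x ∈ Icc 0 (min A₁ A₂), Y₁ x ≠ Y₂ x := by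
    intro x hx he
    obtain ⟨t, ht, het⟩ := iY₁ x ⟨hx.1, hx.2.trans (min_le_left _ _)⟩
    obtain ⟨u, hu, heu⟩ := iY₂ x ⟨hx.1, hx.2.trans (min_le_right _ _)⟩
    exact h₁.ne_of_ne h₂ hs.ne ht hu (by rw [het, heu, he])
  have neZ : ∀ x ∈ Icc 0 (min A₁ A₂), Z₁ x ≠ Z₂ x := by
    intro x hx he
    obtain ⟨t, ht, het⟩ := iZ₁ x ⟨hx.1, hx.2.trans (min_le_left _ _)⟩
    obtain ⟨u, hu, heu⟩ := iZ₂ x ⟨hx.1, hx.2.trans (min_le_right _ _)⟩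
    exact h₁.ne_of_ne h₂ hs.ne ht hu (by rw [het, heu, he])
  have m0 : (0 : ℝ) ≤ min A₁ A₂ := le_min (by linarith) (by linarith)
  have ltY : ∀ x ∈ Icc 0 (min A₁ A₂), Y₁ x < Y₂ x := fun x hx =>
    lt_of_continuousOn_of_ne (l₁.upper.continuousOn.mono (Icc_subset_Icc_right (min_le_left _ _)))
      (l₂.upper.continuousOn.mono (Icc_subset_Icc_right (min_le_right _ _))) neY
      (left_mem_Icc.2 m0) (by rwa [eY₁, eY₂]) hx
  have hA : A₁ < A₂ := by
    by_contra! hn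
    have h := ltY A₂ ⟨by linarith, (min_eq_right hn).ge⟩
    rw [l₂.upper_end] at h
    rcases hn.eq_or_lt with he | hl
    · rw [he, l₁.upper_end] at h; exact lt_irrefl _ h
    · linarith [l₁.upper_pos A₂ ⟨by linarith, hl⟩]
  rw [min_eq_left hA.le] at ltY neZ
  refine ⟨A₁, Y₁, Z₁, A₂, Y₂, Z₂, l₁, l₂, hA, fun x hx => ⟨ltY x hx, ?_⟩, eY₁, eZ₁, eY₂, eZ₂⟩
  refine lt_of_continuousOn_of_ne (l₂.lower.continuousOn.mono (Icc_subset_Icc_right hA.le))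
    l₁.lower.continuousOn (fun x hx => (neZ x hx).symm) (x₀ := A₁)
    (right_mem_Icc.2 (by linarith)) ?_ hx
  rw [l₁.lower_end]
  exact l₂.lower_neg A₁ ⟨by linarith, hA⟩

lemma IsHalfOrbit.lt_of_lt {τ₁ s₁ r₁ τ₂ s₂ r₂ : ℝ} (h₁ : p.IsHalfOrbit γ₁ τ₁ s₁ r₁)
    (h₂ : p.IsHalfOrbit γ₂ τ₂ s₂ r₂) (hs : s₁ < s₂) : r₁ < r₂ := by
  obtain ⟨A₁, Y₁, Z₁, A₂, Y₂, Z₂, l₁, l₂, hA, hlt, eY₁, eZ₁, eY₂, eZ₂⟩ := h₁.nested h₂ hs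
  have := (hlt 0 (left_mem_Icc.2 (by linarith [l₁.one_lt]))).2
  rw [eZ₁, eZ₂] at this
  linarith

end Params

end

noncomputable section

namespace Params

variable {p : Params}

lemma Psi_pos_of_disc_neg {x : ℝ} (hx : p.disc x < 0) (y : ℝ) : 0 < p.Psi x y := by
  nlinarith [p.Psi_eq x y, sq_nonneg (2 * y + p.F x)]

lemma Psi_sub (p : Params) (x y y' : ℝ) :
    p.Psi x y = p.Psi x y' + (y - y') * (y + y' + p.F x) := by
  unfold Psi; ring

lemma ne_zero_of_disc_nonneg {x y : ℝ} (hx : 0 ≤ p.disc x) (h : 0 < p.Psi x y) :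
    0 ≠ 2 * y + p.F x := by
  intro h0
  have := p.Psi_eq x y
  rw [← h0] at this
  nlinarith

namespace IsHalfLoop

variable {A : ℝ} {Y Z : ℝ → ℝ}

lemma upper_add_F_pos (h : p.IsHalfLoop A Y Z) {x : ℝ} (hx : x ∈ Icc 0 A)
    (hxβ : x ≤ p.beta) (hd : 0 ≤ p.disc x) : 0 < 2 * Y x + p.F x := by
  have F0 : p.F 0 = 0 := by simp [F]
  have Y0 : 0 < Y 0 := h.upper_pos 0 ⟨le_rfl, by linarith [h.one_lt]⟩
  refine lt_of_continuousOn_of_ne (a := 0) (b := x) (f := fun _ => 0)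
    (g := fun x => 2 * Y x + p.F x) continuousOn_const
    (((h.upper.continuousOn.mono (Icc_subset_Icc_right hx.2)).const_smul (2 : ℝ)).add
      p.continuous_F.continuousOn) ?_ (left_mem_Icc.2 hx.1)
    (by rw [F0]; linarith) (right_mem_Icc.2 hx.1)
  intro u hu
  rcases hu.1.eq_or_lt with rfl | hu0
  · rw [F0]; linarith
  · exact ne_zero_of_disc_nonneg (p.disc_nonneg_of_le hu.1 hu.2 hxβ hd)
      (h.Psi_upper u ⟨hu0, hu.2.trans hx.2⟩)

/-- `Ψ > 0` above the upper arc. -/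
lemma Psi_pos_above (h : p.IsHalfLoop A Y Z) {x y : ℝ} (hx : x ∈ Icc 0 A)
    (hY : 0 < p.Psi x (Y x)) (hy : Y x ≤ y) : 0 < p.Psi x y := by
  have Yn : 0 ≤ Y x := by
    rcases hx.2.eq_or_lt with he | hl
    · rw [he, h.upper_end]
    · exact (h.upper_pos x ⟨hx.1, hl⟩).le
  rcases le_total p.beta x with hβ | hβ
  · have := p.F_nonneg hx.1 (p.beta_sq_le hβ)
    rw [p.Psi_sub x y (Y x)]
    nlinarith [mul_nonneg (sub_nonneg.2 hy) (show 0 ≤ y + Y x + p.F x by linarith)]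
  · rcases lt_or_ge (p.disc x) 0 with hd | hd
    · exact Psi_pos_of_disc_neg hd y
    · have := h.upper_add_F_pos hx hβ hd
      rw [p.Psi_sub x y (Y x)]
      nlinarith [mul_nonneg (sub_nonneg.2 hy) (show 0 ≤ y + Y x + p.F x by linarith)]

lemma Psi_zero_pos (h : p.IsHalfLoop A Y Z) {x : ℝ} (hx : A ≤ x) : 0 < p.Psi x 0 := by
  have h1 := h.one_lt
  have h2 := h.Psi_upper A ⟨by linarith, le_rfl⟩
  rw [h.upper_end, Psi_zero_right] at h2
  rw [Psi_zero_right]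
  linarith [p.G_mono h1.le hx]

/-- `Ψ > 0` above the `x`-axis on the right of the loop. -/
lemma Psi_pos_right (h : p.IsHalfLoop A Y Z) {x y : ℝ} (hx : A ≤ x) (hy : 0 ≤ y) :
    0 < p.Psi x y := by
  have h1 := h.one_lt
  have h0 := h.Psi_zero_pos hx
  rcases le_total p.beta x with hβ | hβ
  · have := p.F_nonneg (by linarith) (p.beta_sq_le hβ)
    rw [p.Psi_sub x y 0]
    nlinarith [mul_nonneg hy (show 0 ≤ y + 0 + p.F x by linarith)]
  · rcases lt_or_ge (p.disc x) 0 with hd | hd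
    · exact Psi_pos_of_disc_neg hd y
    · exfalso
      have := h.upper_add_F_pos (x := A) ⟨by linarith, le_rfl⟩ (hx.trans hβ)
        (p.disc_nonneg_of_le (by linarith) hx hβ hd)
      rw [h.upper_end] at this
      linarith [p.F_nonpos (show 0 ≤ A by linarith) (p.sq_le_of_le_beta (by linarith)
        (hx.trans hβ))]

/-- `Ψ > 0` between the lower arc and a higher point of the same vertical line where `Ψ > 0`. -/
lemma Psi_pos_below (h : p.IsHalfLoop A Y Z) {x y b : ℝ} (hx : x ∈ Icc 0 A) (hb : b ≤ 0)
    (hΨ : 0 < p.Psi x b) (hyb : y ≤ b) (hy : Z x ≤ y) : 0 < p.Psi x y := by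
  rcases le_total x p.beta with hβ | hβ
  · have := p.F_nonpos hx.1 (p.sq_le_of_le_beta hx.1 hβ)
    rw [p.Psi_sub x y b]
    nlinarith [mul_nonneg (sub_nonneg.2 hyb) (show 0 ≤ -(y + b + p.F x) by linarith)]
  · rcases lt_or_ge (p.disc x) 0 with hd | hd
    · exact Psi_pos_of_disc_neg hd y
    · have hne : ∀ u ∈ Icc x A, 0 ≠ 2 * Z u + p.F u := fun u hu =>
        ne_zero_of_disc_nonneg (p.disc_nonneg_of_ge hβ hu.1 hd) (h.Psi_lower u ⟨hx.1.trans hu.1, hu.2⟩)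
      have hA := hne A (right_mem_Icc.2 hx.2)
      rw [h.lower_end] at hA
      have FA := p.F_nonneg (show 0 ≤ A by linarith [h.one_lt]) (p.beta_sq_le (hβ.trans hx.2))
      have : 0 < 2 * Z x + p.F x := by
        refine lt_of_continuousOn_of_ne (f := fun _ => 0)
          (g := fun x => 2 * Z x + p.F x) continuousOn_const
          (((h.lower.continuousOn.mono (Icc_subset_Icc_left hx.1)).const_smul (2 : ℝ)).add
            p.continuous_F.continuousOn) hne (right_mem_Icc.2 hx.2) ?_ (left_mem_Icc.2 hx.2)
        rw [h.lower_end]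
        exact lt_of_le_of_ne (by linarith) hA
      rw [p.Psi_sub x y (Z x)]
      nlinarith [mul_nonneg (sub_nonneg.2 hy) (show 0 ≤ y + Z x + p.F x by linarith),
        h.Psi_lower x hx]

end IsHalfLoop

lemma segment_mem {y₁ y₂ t : ℝ} (hy : y₁ ≤ y₂) (ht : t ∈ Icc (0 : ℝ) 1) :
    y₁ ≤ y₁ + (y₂ - y₁) * t ∧ y₁ + (y₂ - y₁) * t ≤ y₂ := by
  have := sub_nonneg.2 hy
  constructor <;> nlinarith [ht.1, ht.2, mul_nonneg this ht.1, mul_nonneg this (sub_nonneg.2 ht.2)]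

/-- A strip integral between two ordered arcs is strictly decreasing. -/
lemma stripInt_lt {Y₁ Y₂ : ℝ → ℝ} {q r : ℝ} (hqr : q < r) (h₁ : p.IsArc Y₁ q r)
    (h₂ : p.IsArc Y₂ q r) (hY : ∀ x ∈ Icc q r, Y₁ x ≤ Y₂ x) (hY' : ∀ x ∈ Ioo q r, Y₁ x < Y₂ x)
    (hΨ : ∀ x ∈ Icc q r, ∀ y, Y₁ x ≤ y → y ≤ Y₂ x → 0 < p.Psi x y) :
    p.stripInt (Y₁ r) (Y₂ r) r < p.stripInt (Y₁ q) (Y₂ q) q := by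
  have hΨ' : ∀ x ∈ Icc q r, ∀ t ∈ Icc (0 : ℝ) 1, p.Psi x (Y₁ x + (Y₂ x - Y₁ x) * t) ≠ 0 :=
    fun x hx t ht => (hΨ x hx _ (segment_mem (hY x hx) ht).1 (segment_mem (hY x hx) ht).2).ne'
  have key : ∀ x ∈ Ioo q r, ∃ I > 0, HasDerivAt (fun x => p.stripInt (Y₁ x) (Y₂ x) x)
      (-((Y₂ x - Y₁ x) * p.Phi x * I)) x := fun x hx => h₁.exists_hasDerivAt_stripInt h₂ hΨ' hx
  choose! I hI dI using key
  refine lt_of_hasDerivAt_nonpos_of_neg (B := p.B) hqr (h₁.continuousOn_stripInt h₂ hΨ') dI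
    (fun x hx => ?_) (fun x hx hB => ?_)
  · have h1 : 0 < Y₂ x - Y₁ x := sub_pos.2 (hY' x hx)
    have h2 := p.Phi_nonneg x
    have h3 := hI x hx
    exact neg_nonpos.2 (by positivity)
  · have h1 : 0 < Y₂ x - Y₁ x := sub_pos.2 (hY' x hx)
    have h2 := p.Phi_pos hB
    have h3 := hI x hx
    exact neg_neg_iff_pos.2 (by positivity)

lemma continuousOn_strip_integrand {x : ℝ} {S : Set ℝ} (h : ∀ y ∈ S, 0 < p.Psi x y) :
    ContinuousOn (fun s => s / p.Psi x s) S := by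
  refine continuousOn_id.div (Continuous.continuousOn ?_) fun y hy => (h y hy).ne'
  unfold Psi; fun_prop

/-- Two distinct half orbits cannot both be symmetric. -/
lemma IsHalfOrbit.start_eq_of_symm {γ₁ γ₂ : ℝ → ℝ × ℝ} {τ₁ s₁ τ₂ s₂ : ℝ}
    (h₁ : p.IsHalfOrbit γ₁ τ₁ s₁ s₁) (h₂ : p.IsHalfOrbit γ₂ τ₂ s₂ s₂) : s₁ = s₂ := by
  wlog hs : s₁ ≤ s₂ generalizing γ₁ γ₂ τ₁ s₁ τ₂ s₂
  · exact (this h₂ h₁ (le_of_not_ge hs)).symm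
  by_contra hne
  obtain ⟨A₁, Y₁, Z₁, A₂, Y₂, Z₂, l₁, l₂, hA, hlt, eY₁, eZ₁, eY₂, eZ₂⟩ :=
    h₁.nested h₂ (lt_of_le_of_ne hs hne)
  have p₁ : 0 < A₁ := by linarith [l₁.one_lt]
  have hsub : Icc 0 A₁ ⊆ Icc 0 A₂ := Icc_subset_Icc_right hA.le
  have Psi₁ : ∀ x ∈ Icc 0 A₁, 0 < p.Psi x (Y₁ x) := by
    intro x hx
    rcases hx.1.eq_or_lt with rfl | h
    · have := l₁.Psi_lower 0 hx
      rw [eZ₁, Psi_zero_left] at this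
      rw [eY₁, Psi_zero_left]; linarith
    · exact l₁.Psi_upper x ⟨h, hx.2⟩
  have Zn : ∀ x ∈ Icc 0 A₁, Z₁ x ≤ 0 := by
    intro x hx
    rcases hx.2.eq_or_lt with he | h
    · rw [he, l₁.lower_end]
    · exact (l₁.lower_neg x ⟨hx.1, h⟩).le
  have up := stripInt_lt p₁ l₁.upper (l₂.upper.mono le_rfl hA.le) (fun x hx => (hlt x hx).1.le)
    (fun x hx => (hlt x (Ioo_subset_Icc_self hx)).1)
    (fun x hx y h _ => l₁.Psi_pos_above hx (Psi₁ x hx) h)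
  have low := stripInt_lt p₁ (l₂.lower.mono le_rfl hA.le) l₁.lower (fun x hx => (hlt x hx).2.le)
    (fun x hx => (hlt x (Ioo_subset_Icc_self hx)).2)
    (fun x hx y h h' => l₂.Psi_pos_below (hsub hx) (Zn x hx) (l₁.Psi_lower x hx) h' h)
  have Psi₂ : ∀ x ∈ Icc A₁ A₂, ∀ y, Z₂ x ≤ y → 0 < p.Psi x y := by
    intro x hx y hy
    rcases le_total 0 y with h | h
    · exact l₁.Psi_pos_right hx.1 h
    · exact l₂.Psi_pos_below ⟨p₁.le.trans hx.1, hx.2⟩ le_rfl (l₁.Psi_zero_pos hx.1) h hy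
  have ord : ∀ x ∈ Ico A₁ A₂, Z₂ x < Y₂ x := fun x hx =>
    (l₂.lower_neg x ⟨p₁.le.trans hx.1, hx.2⟩).trans (l₂.upper_pos x ⟨p₁.le.trans hx.1, hx.2⟩)
  have cap := stripInt_lt hA (l₂.lower.mono p₁.le le_rfl) (l₂.upper.mono p₁.le le_rfl)
    (fun x hx => by
      rcases hx.2.eq_or_lt with he | h
      · rw [he, l₂.lower_end, l₂.upper_end]
      · exact (ord x ⟨hx.1, h⟩).le)
    (fun x hx => ord x ⟨hx.1.le, hx.2⟩) (fun x hx y h _ => Psi₂ x hx y h)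
  have m₁ : A₁ ∈ Icc A₁ A₂ := left_mem_Icc.2 hA.le
  have ii : ∀ u v, Z₂ A₁ ≤ u → u ≤ v →
      IntervalIntegrable (fun s => s / p.Psi A₁ s) MeasureTheory.volume u v := by
    intro u v hu huv
    refine (continuousOn_strip_integrand fun y hy => Psi₂ A₁ m₁ y ?_).intervalIntegrable
    rw [uIcc_of_le huv] at hy
    exact hu.trans hy.1
  have hZ : Z₂ A₁ ≤ 0 := (l₂.lower_neg A₁ ⟨p₁.le, hA⟩).le
  have hY : 0 ≤ Y₂ A₁ := (l₂.upper_pos A₁ ⟨p₁.le, hA⟩).le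
  have glue := intervalIntegral.integral_add_adjacent_intervals (ii _ _ le_rfl hZ) (ii _ _ hZ hY)
  have symm : p.stripInt (-s₂) (-s₁) 0 = -p.stripInt s₁ s₂ 0 := by
    unfold stripInt
    rw [← intervalIntegral.integral_comp_neg, ← intervalIntegral.integral_neg]
    refine intervalIntegral.integral_congr fun s _ => ?_
    simp only [Psi_zero_left]
    rw [neg_sq, neg_div]
  simp only [l₁.upper_end, l₁.lower_end, l₂.upper_end, l₂.lower_end, eY₁, eZ₁, eY₂, eZ₂, symm]
    at up low cap
  have z : p.stripInt 0 0 A₂ = 0 := by simp [stripInt]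
  simp only [stripInt] at up low cap z
  linarith

end Params

end

/-- A function whose derivative is bounded away from zero with a constant sign is unbounded. -/
theorem false_of_bounded_of_deriv {w w' : ℝ → ℝ} {T k C : ℝ}
    (d : ∀ t, T ≤ t → HasDerivAt w (w' t) t) (hk : 0 < k)
    (h : (∀ t, T ≤ t → k ≤ w' t) ∨ ∀ t, T ≤ t → w' t ≤ -k) (hb : ∀ t, T ≤ t → |w t| ≤ C) :
    False := by
  wlog h' : ∀ t, T ≤ t → k ≤ w' t generalizing w w'
  · have h'' := h.resolve_left h'
    have h3 : ∀ t, T ≤ t → k ≤ -w' t := fun t ht => by linarith [h'' t ht]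
    exact this (w := fun t => -w t) (w' := fun t => -w' t) (fun t ht => (d t ht).neg) (.inl h3)
      (fun t ht => by simpa using hb t ht) h3
  set t := T + (2 * C + 1) / k
  have C0 : 0 ≤ C := (abs_nonneg _).trans (hb T le_rfl)
  have ht : T ≤ t := by
    have : 0 ≤ (2 * C + 1) / k := by positivity
    simp only [t]; linarith
  have := (convex_Ici T).mul_sub_le_image_sub_of_le_deriv (f := w) (C := k)
    (fun u hu => (d u hu).continuousAt.continuousWithinAt)
    (fun u hu => (d u (interior_subset hu)).differentiableAt.differentiableWithinAt)
    (fun u hu => by rw [(d u (interior_subset hu)).deriv]; exact h' u (interior_subset hu))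
    T self_mem_Ici t ht ht
  have e : k * (t - T) = 2 * C + 1 := by simp only [t]; field_simp; ring
  have h1 := abs_le.1 (hb T le_rfl)
  have h2 := abs_le.1 (hb t ht)
  linarith [h1.1, h2.2]

theorem exists_tendsto_of_deriv_nonneg {x y : ℝ → ℝ} {T R : ℝ}
    (d : ∀ t, T ≤ t → HasDerivAt x (y t) t) (hy : ∀ t, T ≤ t → 0 ≤ y t)
    (hb : ∀ t, T ≤ t → |x t| ≤ R) : ∃ l, Tendsto x atTop (𝓝 l) := by
  have mono : MonotoneOn x (Ici T) := by
    refine monotoneOn_of_deriv_nonneg (convex_Ici T)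
      (fun u hu => (d u hu).continuousAt.continuousWithinAt)
      (fun u hu => (d u (interior_subset hu)).differentiableAt.differentiableWithinAt)
      (fun u hu => by rw [(d u (interior_subset hu)).deriv]; exact hy u (interior_subset hu))
  have m : Monotone fun t => x (max t T) := fun t u htu =>
    mono (mem_Ici.2 (le_max_right _ _)) (mem_Ici.2 (le_max_right _ _)) (max_le_max_right T htu)
  refine ⟨_, (tendsto_atTop_ciSup m ⟨R, ?_⟩).congr' ?_⟩
  · rintro _ ⟨t, rfl⟩
    exact (abs_le.1 (hb _ (le_max_right _ _))).2
  · filter_upwards [eventually_ge_atTop T] with t ht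
    rw [max_eq_left ht]

noncomputable section

namespace Params

variable {p : Params} {γ : ℝ → ℝ × ℝ}

lemma sq_le_one_of_g_eq_zero {x : ℝ} (h : p.g x = 0) : x ^ 2 ≤ 1 := by
  have ha := p.ha
  unfold g at h
  rcases mul_eq_zero.1 h with h | h
  · rcases mul_eq_zero.1 h with h | h
    · rw [h]; norm_num
    · linarith
  · linarith

/-- No bounded solution keeps `0 < Ψ`, `0 < x` and a velocity of constant sign forever. -/
lemma IsSolOn.false_of_snd_sign {T R : ℝ} (h : p.IsSolOn γ (Ici T))
    (hb : ∀ t, T ≤ t → |(γ t).1| ≤ R ∧ |(γ t).2| ≤ R)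
    (hΨ : ∀ t, T ≤ t → 0 < p.Psi (γ t).1 (γ t).2)
    (hs : (∀ t, T ≤ t → 0 < (γ t).2) ∨ ∀ t, T ≤ t → (γ t).2 < 0) : False := by
  obtain ⟨l, hl⟩ : ∃ l, Tendsto (fun t => (γ t).1) atTop (𝓝 l) := by
    rcases hs with hs | hs
    · exact exists_tendsto_of_deriv_nonneg (fun t ht => h.fst ht) (fun t ht => (hs t ht).le)
        fun t ht => (hb t ht).1
    · obtain ⟨l, hl⟩ := exists_tendsto_of_deriv_nonneg (x := fun t => -(γ t).1)
        (fun t ht => (h.fst ht).neg) (fun t ht => neg_nonneg.2 (hs t ht).le)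
        fun t ht => by simpa using (hb t ht).1
      exact ⟨-l, by simpa using hl.neg⟩
  by_cases hg : p.g l = 0
  · have hΨl := p.Psi_neg_of_sq_le (sq_le_one_of_g_eq_zero hg)
    have hev : ∀ᶠ z in 𝓝 (l, (0 : ℝ)), p.Psi z.1 z.2 < 0 :=
      p.continuous_Psi.continuousAt.eventually_lt_const hΨl
    rw [nhds_prod_eq] at hev
    obtain ⟨U, hU, V, hV, hUV⟩ := eventually_prod_iff.1 hev
    obtain ⟨η, hη, hηV⟩ := Metric.eventually_nhds_iff.1 hV
    obtain ⟨T', hT'⟩ := eventually_atTop.1 ((hl.eventually hU).and (eventually_ge_atTop T))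
    have far : ∀ t, T' ≤ t → η ≤ |(γ t).2| := by
      intro t ht
      by_contra! hn
      have := hUV (hT' t ht).1 (hηV (y := (γ t).2) (by simpa using hn))
      exact absurd (hΨ t (hT' t ht).2) (not_lt.2 this.le)
    refine false_of_bounded_of_deriv (w := fun t => (γ t).1) (w' := fun t => (γ t).2) (T := T')
      (fun t ht => h.fst (hT' t ht).2) hη ?_ (fun t ht => (hb t (hT' t ht).2).1)
    rcases hs with hs | hs
    · refine .inl fun t ht => ?_
      simpa [abs_of_pos (hs t (hT' t ht).2)] using far t ht
    · refine .inr fun t ht => ?_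
      have := far t ht
      rw [abs_of_neg (hs t (hT' t ht).2)] at this
      linarith
  · have hgl : Tendsto (fun t => p.g (γ t).1) atTop (𝓝 (p.g l)) :=
      (p.continuous_g.tendsto l).comp hl
    have hgp : 0 < |p.g l| := abs_pos.2 hg
    obtain ⟨T', hT'⟩ := eventually_atTop.1 ((hgl.eventually (Metric.ball_mem_nhds _
      (half_pos hgp))).and (eventually_ge_atTop T))
    obtain ⟨D, hD⟩ := (isCompact_Icc (a := -R) (b := R)).exists_bound_of_continuousOn
      p.continuous_F.continuousOn
    refine false_of_bounded_of_deriv (w := fun t => (γ t).2 + p.F (γ t).1)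
      (w' := fun t => -p.g (γ t).1) (T := T') (C := R + D) (fun t ht => ?_) (half_pos hgp) ?_
      (fun t ht => ?_)
    · have ht' := (hT' t ht).2
      have e1 := (p.hasDerivAt_F (γ t).1).comp t (h.fst ht')
      exact ((h.snd ht').add e1).congr_deriv (by ring)
    · have near : ∀ t, T' ≤ t → |p.g (γ t).1 - p.g l| < |p.g l| / 2 := fun t ht => (hT' t ht).1
      rcases lt_or_gt_of_ne hg with hn | hn
      · refine .inl fun t ht => ?_
        have := abs_lt.1 (near t ht)
        rw [abs_of_neg hn] at *
        linarith [this.2]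
      · refine .inr fun t ht => ?_
        have := abs_lt.1 (near t ht)
        rw [abs_of_pos hn] at *
        linarith [this.1]
    · have hb' := hb t (hT' t ht).2
      have := hD (γ t).1 (abs_le.1 hb'.1)
      exact (abs_add_le _ _).trans (add_le_add hb'.2 this)

lemma IsSolOn.isHalfOrbit {τ s : ℝ} (h : p.IsSolOn γ (Icc 0 τ)) (hτ : 0 < τ) (h0 : γ 0 = (0, s))
    (hx : (γ τ).1 = 0) (hpos : ∀ t ∈ Ioo 0 τ, 0 < (γ t).1) (hs : 0 < s) (hc : p.c ≤ s ^ 2) :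
    p.IsHalfOrbit γ τ s (-(γ τ).2) ∧ p.c < (γ τ).2 ^ 2 := by
  have hΨ := h.Psi_pos hτ (by rw [h0, Psi_zero_left]; linarith)
  rw [hx, Psi_zero_left] at hΨ
  refine ⟨⟨h, hτ, h0, by rw [neg_neg, ← hx], hpos, hs, hc, ?_⟩, by linarith⟩
  by_contra! hn
  have hne : (γ τ).2 ≠ 0 := by
    intro h
    rw [h] at hΨ
    linarith [p.c_pos]
  have hy : 0 < (γ τ).2 := lt_of_le_of_ne (by linarith) hne.symm
  have := (h.fst (right_mem_Icc.2 hτ.le)).eventually_neg_left hx hy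
  obtain ⟨u, hu, hu'⟩ := (this.and (Ioo_mem_nhdsLT hτ)).exists
  linarith [hpos u hu']

/-- Bounded solutions issued from the positive `y`-axis with `0 ≤ Ψ` come back to the `y`-axis. -/
lemma IsSolOn.exists_isHalfOrbit {R s : ℝ} (h : p.IsSolOn γ (Ici 0)) (h0 : γ 0 = (0, s))
    (hb : ∀ t, 0 ≤ t → |(γ t).1| ≤ R ∧ |(γ t).2| ≤ R) (hs : 0 < s) (hc : p.c ≤ s ^ 2) :
    ∃ τ, p.IsHalfOrbit γ τ s (-(γ τ).2) ∧ p.c < (γ τ).2 ^ 2 ∧ (γ τ).1 = 0 := by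
  have m0 : (0 : ℝ) ∈ Ici (0 : ℝ) := self_mem_Ici
  have sub : ∀ {a b : ℝ}, 0 ≤ a → Icc a b ⊆ Ici 0 := fun ha u hu => ha.trans hu.1
  have c1 : ∀ {a b : ℝ}, 0 ≤ a → ContinuousOn (fun t => (γ t).1) (Icc a b) := fun ha t ht =>
    (h.fst (sub ha ht)).continuousAt.continuousWithinAt
  have c2 : ∀ {a b : ℝ}, 0 ≤ a → ContinuousOn (fun t => (γ t).2) (Icc a b) := fun ha t ht =>
    (h.snd (sub ha ht)).continuousAt.continuousWithinAt
  by_cases hret : ∃ b > 0, (γ b).1 ≤ 0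
  · obtain ⟨b, hb0, hb1⟩ := hret
    have ev := (h.fst m0).eventually_pos_right (by rw [h0]) (by rw [h0]; exact hs)
    obtain ⟨τ, hτ, hx, hp⟩ := exists_first_zero hb0 (c1 le_rfl) ev hb1
    have := (h.mono (sub le_rfl)).isHalfOrbit hτ.1 h0 hx hp hs hc
    exact ⟨τ, this.1, this.2, hx⟩
  exfalso
  push Not at hret
  have hΨ : ∀ t, 0 < t → 0 < p.Psi (γ t).1 (γ t).2 := fun t ht =>
    (h.mono (sub le_rfl)).Psi_pos ht (by rw [h0, Psi_zero_left]; linarith)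
  have hg : ∀ t, 0 < t → (γ t).2 = 0 → 0 < p.g (γ t).1 := by
    intro t ht hy
    have h1 := hΨ t ht
    rw [hy] at h1
    refine p.g_pos ?_
    by_contra! hn
    linarith [p.Psi_neg_of_sq_le (x := (γ t).1) (by nlinarith [hret t ht])]
  obtain ⟨T, hT, hsign⟩ : ∃ T > 0, (∀ t, T ≤ t → 0 < (γ t).2) ∨ ∀ t, T ≤ t → (γ t).2 < 0 := by
    by_cases hy : ∃ b > 0, (γ b).2 ≤ 0
    · obtain ⟨b, hb0, hb1⟩ := hy
      have ev : ∀ᶠ t in 𝓝[>] (0 : ℝ), 0 < (γ t).2 :=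
        ((h.snd m0).continuousAt.eventually_const_lt
          (by simpa [h0] using hs)).filter_mono nhdsWithin_le_nhds
      obtain ⟨t₁, ht₁, hy₁, -⟩ := exists_first_zero hb0 (c2 le_rfl) ev hb1
      refine ⟨t₁ + 1, by linarith [ht₁.1], .inr fun t ht => ?_⟩
      exact (h.mono (sub ht₁.1.le)).snd_neg_of_zero (by linarith) hy₁ fun u hu =>
        hg u (ht₁.1.trans_le hu.1)
    · push Not at hy
      exact ⟨1, one_pos, .inl fun t ht => hy t (by linarith)⟩
  exact (h.mono (Ici_subset_Ici.2 hT.le)).false_of_snd_sign (fun t ht => hb t (hT.le.trans ht))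
    (fun t ht => hΨ t (hT.trans_le ht)) hsign

end Params

/-- A monotone self-map of a compact interval has a fixed point. -/
theorem exists_fixed_of_monotoneOn {a b : ℝ} (hab : a ≤ b) {φ : ℝ → ℝ}
    (hφ : MapsTo φ (Icc a b) (Icc a b)) (mono : MonotoneOn φ (Icc a b)) :
    ∃ u ∈ Icc a b, φ u = u := by
  set S := {s ∈ Icc a b | s ≤ φ s}
  have bdd : BddAbove S := ⟨b, fun s hs => hs.1.2⟩
  have ha : a ∈ S := ⟨left_mem_Icc.2 hab, (hφ (left_mem_Icc.2 hab)).1⟩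
  have hu : sSup S ∈ Icc a b := ⟨le_csSup bdd ha, csSup_le ⟨a, ha⟩ fun s hs => hs.1.2⟩
  have h1 : sSup S ≤ φ (sSup S) :=
    csSup_le ⟨a, ha⟩ fun s hs => hs.2.trans (mono hs.1 hu (le_csSup bdd hs))
  exact ⟨sSup S, hu, le_antisymm (le_csSup bdd ⟨hφ hu, mono hu (hφ hu) h1⟩) h1⟩

namespace Params

/-- System (II) has a nonconstant periodic solution. -/
theorem exists_periodic (p : Params) : ∃ Γ : ℝ → ℝ × ℝ, ∃ T > 0, p.IsSolOn Γ univ ∧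
    Function.Periodic Γ T ∧ ¬ ∀ t s, Γ t = Γ s := by
  obtain ⟨M, R, hcM, hM, hR, trap⟩ := p.exists_trapping
  have hc := p.c_pos
  have key : ∀ s ∈ Icc √p.c M, ∃ r ∈ Icc √p.c M, ∃ Γ : ℝ → ℝ × ℝ, ∃ τ,
      (∀ t, HasDerivAt Γ (p.XClamp R (Γ t)) t) ∧ p.IsHalfOrbit Γ τ s r := by
    intro s hs
    have s0 : 0 < s := (Real.sqrt_pos.2 hc).trans_le hs.1
    have hcs : p.c ≤ s ^ 2 := (Real.sqrt_le_left s0.le).1 hs.1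
    obtain ⟨Γ, hΓ0, hΓ⟩ := p.exists_clamp_solution hR (0, s)
    have tr := trap Γ hΓ (by rw [hΓ0]) (by rw [hΓ0]; exact (abs_of_pos s0).le.trans hs.2)
    have sol : p.IsSolOn Γ (Ici 0) := fun t ht => by
      rw [← p.XClamp_of_mem (tr t ht).1 (tr t ht).2.1]
      exact hΓ t
    obtain ⟨τ, hτ, hcr, hx⟩ := sol.exists_isHalfOrbit hΓ0
      (fun t ht => ⟨(tr t ht).1, (tr t ht).2.1⟩) s0 hcs
    refine ⟨_, ⟨?_, ?_⟩, Γ, τ, hΓ, hτ⟩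
    · rw [Real.sqrt_le_left hτ.finish_pos.le, neg_sq]
      exact hcr.le
    · exact (neg_le_abs _).trans ((tr τ hτ.time_pos.le).2.2 hx)
  choose! φ hφ Γ τ hΓ hH using key
  obtain ⟨s, hs, he⟩ := exists_fixed_of_monotoneOn ((Real.sqrt_le_left hM.le).2 hcM.le) hφ
    (fun s hs t ht hst => by
      rcases hst.eq_or_lt with rfl | hlt
      · exact le_rfl
      · exact ((hH s hs).lt_of_lt (hH t ht) hlt).le)
  have H := hH s hs
  have hd := hΓ s hs
  rw [he] at H
  set η := Γ s
  set u := τ s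
  obtain ⟨K, hK⟩ := p.exists_lipschitzWith_XClamp hR
  have anti : ∀ t, η (t + u) = -η t := by
    have := ODE_solution_unique_univ (v := fun _ => p.XClamp R) (s := fun _ => univ) (t₀ := 0)
      (f := fun t => η (t + u)) (g := fun t => -η t) (fun _ => hK.lipschitzOnWith)
      (fun t => ⟨(hd (t + u)).comp_add_const t u, mem_univ _⟩)
      (fun t => ⟨by rw [p.XClamp_neg hR]; exact (hd t).neg, mem_univ _⟩)
      (by simp [H.start, H.finish])
    exact fun t => congrFun this t
  have per : Function.Periodic η (u + u) := fun t => by rw [← add_assoc, anti, anti, neg_neg]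
  have u0 := H.time_pos
  have s0 := H.start_pos
  have tr := trap η hd (by rw [H.start]) (by rw [H.start]; exact (abs_of_pos s0).le.trans hs.2)
  refine ⟨η, u + u, by linarith, fun t _ => ?_, per, fun hn => ?_⟩
  · have hp := hd t
    obtain ⟨v, hv, e⟩ := per.exists_mem_Ico₀ (by linarith) t
    have := p.XClamp_of_mem (tr v hv.1).1 (tr v hv.1).2.1
    rw [← e] at this
    rwa [this] at hp
  · have := congrArg Prod.snd (hn 0 u)
    rw [H.start, H.finish] at this
    simp only at this
    linarith

end Params

end

noncomputable section

namespace Params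

variable {p : Params} {γ γ₁ γ₂ : ℝ → ℝ × ℝ}

lemma IsSolOn.continuous_univ (h : p.IsSolOn γ univ) : Continuous γ :=
  continuous_iff_continuousAt.2 fun t => h.continuousAt (mem_univ t)

/-- Nonconstant periodic solutions cross the `y`-axis. -/
lemma IsSolOn.exists_fst_eq_zero (h : p.IsSolOn γ univ) (hn : ¬ ∀ t s, γ t = γ s) {T : ℝ}
    (hT : 0 < T) (hper : Function.Periodic γ T) : ∃ t, (γ t).1 = 0 := by
  obtain ⟨t₀, -, hy₀, hg₀⟩ := h.exists_isMin hn hT hper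
  obtain ⟨t₁, h01, hy₁, hg₁, -⟩ := h.exists_right_arc hn hT hper hy₀ hg₀
  have hΨ := h.Psi_pos_of_periodic hn hT hper
  have far : ∀ t, (γ t).2 = 0 → 1 < (γ t).1 ^ 2 := by
    intro t hy
    have := hΨ t
    rw [hy] at this
    by_contra! hn
    linarith [p.Psi_neg_of_sq_le hn]
  have h0 : (γ t₀).1 ≤ 0 := by
    by_contra! hx
    exact absurd (p.g_pos (x := (γ t₀).1) (by nlinarith [far t₀ hy₀])) (not_lt.2 hg₀.le)
  have h1 : 0 ≤ (γ t₁).1 := by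
    by_contra! hx
    have := p.g_pos (x := -(γ t₁).1) (by nlinarith [far t₁ hy₁])
    rw [g_neg_arg] at this
    linarith
  exact mem_range_of_exists_le_of_exists_ge (continuous_fst.comp h.continuous_univ) ⟨t₀, h0⟩
    ⟨t₁, h1⟩

/-- A periodic solution is symmetric if it starts at its highest point on the `y`-axis. -/
lemma IsSolOn.exists_isHalfOrbit_of_max (h : p.IsSolOn γ univ) {T s : ℝ} (hT : 0 < T)
    (hper : Function.Periodic γ T) (hΨ : ∀ t, 0 < p.Psi (γ t).1 (γ t).2) (h0 : γ 0 = (0, s))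
    (hs : 0 < s) (hmax : ∀ t, (γ t).1 = 0 → |(γ t).2| ≤ s) : ∃ τ, p.IsHalfOrbit γ τ s s := by
  have hc : ∀ t, (γ t).1 = 0 → p.c ≤ (γ t).2 ^ 2 := by
    intro t hx
    have := hΨ t
    rw [hx, Psi_zero_left] at this
    linarith
  have hcs : p.c ≤ s ^ 2 := by simpa [h0] using hc 0 (by rw [h0])
  have c1 : Continuous fun t => (γ t).1 := continuous_fst.comp h.continuous_univ
  have d0 : HasDerivAt (fun t => (γ t).1) s 0 := by simpa [h0] using h.fst (mem_univ 0)
  obtain ⟨τ, hτ, hx, hp⟩ := exists_first_zero hT c1.continuousOn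
    (d0.eventually_pos_right (by rw [h0]) hs) (by rw [hper.eq, h0])
  have H := ((h.mono (subset_univ _)).isHalfOrbit hτ.1 h0 hx hp hs hcs).1
  have d0' : HasDerivAt (fun t => -(γ (-t)).1) s 0 := by
    have e : HasDerivAt (fun t => (γ t).1) s (-0) := by simpa using d0
    exact ((HasDerivAt.scomp (0 : ℝ) e (hasDerivAt_neg (0 : ℝ))).neg).congr_deriv (by simp)
  obtain ⟨σ, hσ, hxσ, hpσ⟩ := exists_first_zero hT (c1.comp continuous_neg).neg.continuousOn
    (d0'.eventually_pos_right (by simp [h0]) hs)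
    (by
      have := hper (-T)
      rw [neg_add_cancel] at this
      simp [← this, h0])
  have hxσ' : (γ (-σ)).1 = 0 := by simpa using hxσ
  set η : ℝ → ℝ × ℝ := fun t => -γ (t + -σ)
  have hη : p.IsSolOn η univ := (h.shift_univ (-σ)).neg
  have hη0 : η 0 = (0, -(γ (-σ)).2) := by
    simp only [η, zero_add]
    exact Prod.ext (by simp [hxσ']) (by simp)
  have hησ : η σ = (0, -s) := by simp [η, h0]
  have hηp : ∀ t ∈ Ioo 0 σ, 0 < (η t).1 := by
    intro t ht
    have := hpσ (σ - t) ⟨by linarith [ht.2], by linarith [ht.1]⟩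
    simpa [η, sub_eq_add_neg] using this
  have hcσ := hc _ hxσ'
  have hs' : 0 < -(γ (-σ)).2 := by
    by_contra! hn
    have hne : (γ (-σ)).2 ≠ 0 := by
      intro h
      rw [h] at hcσ
      linarith [p.c_pos]
    have hy : 0 < (γ (-σ)).2 := lt_of_le_of_ne (by linarith) hne.symm
    have := ((hη.fst (mem_univ 0)).neg).eventually_pos_right (by simp [hη0])
      (by rw [hη0]; simpa using hy)
    obtain ⟨u, hu, hu'⟩ := (this.and (Ioo_mem_nhdsGT hσ.1)).exists
    linarith [hηp u hu', show 0 < -(η u).1 from hu]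
  have K := ((hη.mono (subset_univ _)).isHalfOrbit hσ.1 hη0 (by rw [hησ]) hηp hs'
    (by rwa [neg_sq])).1
  rw [hησ] at K
  simp only [neg_neg] at K
  have hle : -(γ (-σ)).2 ≤ s := (neg_le_abs _).trans (hmax _ hxσ')
  rcases hle.eq_or_lt with he | hlt
  · rw [he] at K hη0
    exact ⟨σ, hη.eq_univ h (hη0.trans h0.symm) ▸ K⟩
  · exact absurd (K.lt_of_lt H hlt) (not_lt.2 ((neg_le_abs _).trans (hmax _ hx)))

/-- A nonconstant periodic solution is symmetric. -/
lemma IsSolOn.exists_isHalfOrbit_symm (h : p.IsSolOn γ univ) (hn : ¬ ∀ t s, γ t = γ s) {T : ℝ}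
    (hT : 0 < T) (hper : Function.Periodic γ T) :
    ∃ s t τ, p.IsHalfOrbit (fun u => γ (u + t)) τ s s := by
  have hΨ := h.Psi_pos_of_periodic hn hT hper
  have cγ := h.continuous_univ
  obtain ⟨t₀, ht₀⟩ := h.exists_fst_eq_zero hn hT hper
  obtain ⟨u₀, hu₀, e₀⟩ := hper.exists_mem_Ico₀ hT t₀
  rw [e₀] at ht₀
  have comp : IsCompact (Icc 0 T ∩ {t | (γ t).1 = 0}) :=
    isCompact_Icc.inter_right (isClosed_eq (continuous_fst.comp cγ) continuous_const)
  obtain ⟨t, ht, hmax⟩ := comp.exists_isMaxOn ⟨u₀, ⟨hu₀.1, hu₀.2.le⟩, ht₀⟩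
    (continuous_snd.comp cγ).abs.continuousOn
  have hmax' : ∀ u, (γ u).1 = 0 → |(γ u).2| ≤ |(γ t).2| := by
    intro u hu
    obtain ⟨v, hv, e⟩ := hper.exists_mem_Ico₀ hT u
    rw [e] at hu ⊢
    exact hmax ⟨⟨hv.1, hv.2.le⟩, hu⟩
  have hx : (γ t).1 = 0 := ht.2
  have hne : (γ t).2 ≠ 0 := by
    intro hy
    have := hΨ t
    rw [hx, hy, Psi_zero_left] at this
    linarith [p.c_pos]
  have per : ∀ u, Function.Periodic (fun v => γ (v + u)) T := fun u v => by
    simp only [add_right_comm v T u, hper (v + u)]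
  rcases lt_or_gt_of_ne hne with hy | hy
  · rw [abs_of_neg hy] at hmax'
    obtain ⟨τ, H⟩ := (h.shift_univ t).neg.exists_isHalfOrbit_of_max (s := -(γ t).2) hT
      (fun v => by simp only [per t v]) (fun v => by simpa [Psi_neg_neg] using hΨ (v + t))
      (by simpa using Prod.ext (by simp [hx]) (by simp)) (by linarith)
      (fun v hv => by simpa using hmax' (v + t) (by simpa using hv))
    have e : γ (τ + t) = (0, -(γ t).2) := by
      have := congrArg Neg.neg H.finish
      simpa using this
    obtain ⟨τ', H'⟩ := (h.shift_univ (τ + t)).exists_isHalfOrbit_of_max hT (per _)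
      (fun v => hΨ _) (by simpa using e) (by linarith) (fun v hv => hmax' _ hv)
    exact ⟨_, _, τ', H'⟩
  · rw [abs_of_pos hy] at hmax'
    obtain ⟨τ, H⟩ := (h.shift_univ t).exists_isHalfOrbit_of_max hT (per t)
      (fun v => hΨ _) (by rw [zero_add]; exact Prod.ext hx rfl) hy (fun v hv => hmax' _ hv)
    exact ⟨_, t, τ, H⟩

/-- Nonconstant periodic solutions of system (II) have the same range. -/
theorem range_eq_of_periodic {T₁ T₂ : ℝ} (h₁ : p.IsSolOn γ₁ univ) (n₁ : ¬ ∀ t s, γ₁ t = γ₁ s)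
    (hT₁ : 0 < T₁) (per₁ : Function.Periodic γ₁ T₁) (h₂ : p.IsSolOn γ₂ univ)
    (n₂ : ¬ ∀ t s, γ₂ t = γ₂ s) (hT₂ : 0 < T₂) (per₂ : Function.Periodic γ₂ T₂) :
    range γ₁ = range γ₂ := by
  obtain ⟨s₁, t₁, τ₁, H₁⟩ := h₁.exists_isHalfOrbit_symm n₁ hT₁ per₁
  obtain ⟨s₂, t₂, τ₂, H₂⟩ := h₂.exists_isHalfOrbit_symm n₂ hT₂ per₂
  have e := (h₁.shift_univ t₁).eq_univ (h₂.shift_univ t₂) (t₀ := 0)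
    (H₁.start.trans ((H₁.start_eq_of_symm H₂) ▸ H₂.start.symm))
  have r : ∀ (γ : ℝ → ℝ × ℝ) t, range (fun u => γ (u + t)) = range γ := fun γ t =>
    (Equiv.addRight t).surjective.range_comp γ
  rw [← r γ₁ t₁, ← r γ₂ t₂, e]

end Params

end

/-- for a1 ≥ 0, δ > 0, a2 ≤ −1, system (II) has a nonconstant periodic
solution, and any two nonconstant periodic solutions have the same image
(exactly one limit cycle). -/
theorem stmt7 (a1 a2 δ : ℝ) (ha1 : 0 ≤ a1) (hδ : 0 < δ) (ha2 : a2 ≤ -1) :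
    (∃ γ : ℝ → ℝ × ℝ, IsNonconstPeriodicSolII a1 a2 δ γ) ∧
    (∀ γ1 γ2 : ℝ → ℝ × ℝ, IsNonconstPeriodicSolII a1 a2 δ γ1 →
      IsNonconstPeriodicSolII a1 a2 δ γ2 → Set.range γ1 = Set.range γ2) := by
  set p : Params := ⟨a1, δ, -a2, ha1, hδ, by linarith⟩
  have hX : ∀ z, p.X z = (z.2, -(z.1 * (a1 + z.1 ^ 2) * (z.1 ^ 2 - 1))
      - δ * (a2 + z.1 ^ 2) * z.2) := fun z =>
    Prod.ext rfl (by simp only [Params.X, Params.g, Params.f, p]; ring)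
  have hsol : ∀ γ, p.IsSolOn γ univ ↔ IsSolII a1 a2 δ γ := fun γ => by
    simp only [Params.IsSolOn, IsSolII, hX, mem_univ, forall_const]
  refine ⟨?_, ?_⟩
  · obtain ⟨γ, T, hT, h, per, hn⟩ := p.exists_periodic
    exact ⟨γ, (hsol γ).1 h, ⟨T, hT, per⟩, hn⟩
  · rintro γ₁ γ₂ ⟨h₁, ⟨T₁, hT₁, per₁⟩, n₁⟩ ⟨h₂, ⟨T₂, hT₂, per₂⟩, n₂⟩
    exact Params.range_eq_of_periodic ((hsol γ₁).2 h₁) n₁ hT₁ per₁ ((hsol γ₂).2 h₂) n₂ hT₂ per₂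
end

section
/- Let δ > 0 and a2 < 0, and take a1 = −1 in system (III), so that system (III) reads x' = y − δ(a2·x + x³/3), y' = −x(x² − 1)². If γ is a periodic solution of this system whose first component satisfies |(γ t).1| ≤ √(−3·a2) for all t ∈ ℝ, then γ is constant. (There are no limit cycles lying in the strip |x| ≤ √(−3a2).) -/
theorem Monotone.eq_of_periodic {f : ℝ → ℝ} {T : ℝ} (hf : Monotone f)
    (hper : Function.Periodic f T) (hT : 0 < T) (t s : ℝ) : f t = f s := by
  have key : ∀ u v : ℝ, f u ≤ f v := fun u v => by
    obtain ⟨n, hn⟩ := Archimedean.arch (u - v) hT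
    calc f u ≤ f (v + n • T) := hf (by linarith)
      _ = f v := hper.nsmul n v
  exact le_antisymm (key t s) (key s t)

theorem Continuous.eq_of_forall_mem_countable {X Y : Type*} [TopologicalSpace X]
    [PreconnectedSpace X] [MetricSpace Y] {f : X → Y} (hf : Continuous f) {S : Set Y}
    (hS : S.Countable) (hmem : ∀ x, f x ∈ S) (x y : X) : f x = f y :=
  hS.isTotallyDisconnected (Set.range f) (Set.range_subset_iff.2 hmem)
    (isPreconnected_range hf) (Set.mem_range_self x) (Set.mem_range_self y)

/-- The energy `y² / 2 + (x² - 1)³ / 6` grows along a solution at the rate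
`-δ x² (x² - 1)² (a2 + x² / 3)`. -/
theorem hasDerivAt_lienard_energy {a2 δ : ℝ} {x y : ℝ → ℝ} {t : ℝ}
    (hx : HasDerivAt x (y t - δ * (a2 * x t + x t ^ 3 / 3)) t)
    (hy : HasDerivAt y (-(x t * (x t ^ 2 - 1) ^ 2)) t) :
    HasDerivAt (fun t => y t ^ 2 / 2 + (x t ^ 2 - 1) ^ 3 / 6)
      (δ * (x t * (x t ^ 2 - 1)) ^ 2 * -(a2 + x t ^ 2 / 3)) t := by
  refine (((hy.pow 2).div_const 2).add
    ((((hx.pow 2).sub_const 1).pow 3).div_const 6)).congr_deriv ?_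
  push_cast
  simp only [Pi.pow_apply]
  ring

/-- for δ > 0, a2 < 0 and a1 = −1, system (III) reads
x' = y − δ(a2 x + x³/3), y' = −x(x² − 1)²; every periodic solution lying in the
strip |x| ≤ √(−3a2) is constant. -/
theorem stmt8 (a2 δ : ℝ) (hδ : 0 < δ) (ha2 : a2 < 0)
    (γ : ℝ → ℝ × ℝ)
    (hsol : ∀ t : ℝ, HasDerivAt γ
      ((γ t).2 - δ * (a2 * (γ t).1 + (γ t).1 ^ 3 / 3),
        -((γ t).1 * ((γ t).1 ^ 2 - 1) ^ 2)) t)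
    (T : ℝ) (hT : 0 < T) (hper : ∀ t : ℝ, γ (t + T) = γ t)
    (hstrip : ∀ t : ℝ, |(γ t).1| ≤ Real.sqrt (-(3 * a2))) :
    ∀ t s : ℝ, γ t = γ s := by
  have hx : ∀ t, HasDerivAt (fun t => (γ t).1)
      ((γ t).2 - δ * (a2 * (γ t).1 + (γ t).1 ^ 3 / 3)) t := fun t => (hsol t).fst
  have hy : ∀ t, HasDerivAt (fun t => (γ t).2)
      (-((γ t).1 * ((γ t).1 ^ 2 - 1) ^ 2)) t := fun t => (hsol t).snd
  have hE := fun t => hasDerivAt_lienard_energy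
    (x := fun t => (γ t).1) (y := fun t => (γ t).2) (hx t) (hy t)
  have hdamp : ∀ t, 0 ≤ -(a2 + (γ t).1 ^ 2 / 3) := fun t => by
    have h := (Real.le_sqrt (abs_nonneg _) (by linarith)).1 (hstrip t)
    rw [sq_abs] at h
    linarith
  have hmono := monotone_of_deriv_nonneg (fun t => (hE t).differentiableAt) fun t => by
    rw [(hE t).deriv]
    exact mul_nonneg (by positivity) (hdamp t)
  have hconst := hmono.eq_of_periodic (T := T) (fun t => by simp only [hper]) hT
  have hzero : ∀ t, δ * ((γ t).1 * ((γ t).1 ^ 2 - 1)) ^ 2 * -(a2 + (γ t).1 ^ 2 / 3) = 0 :=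
    fun t => (hE t).unique <|
      (hasDerivAt_const t _).congr_of_eventuallyEq (.of_forall fun s => hconst s t)
  set r := Real.sqrt (-(3 * a2)) with hr
  have hmem : ∀ t, (γ t).1 ∈ ({0, 1, -1, r, -r} : Set ℝ) := fun t => by
    simp only [Set.mem_insert_iff, Set.mem_singleton_iff]
    rcases mul_eq_zero.1 (hzero t) with h | h
    · have h' : (γ t).1 * ((γ t).1 ^ 2 - 1) = 0 := by simpa [hδ.ne'] using h
      rcases mul_eq_zero.1 h' with h0 | h1
      · exact .inl h0
      · have h2 : (γ t).1 ^ 2 = 1 := sub_eq_zero.1 h1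
        rcases sq_eq_sq_iff_eq_or_eq_neg.1 (h2.trans (one_pow 2).symm) with h | h <;> simp [h]
    · have h' : (γ t).1 ^ 2 = r ^ 2 := by
        rw [hr, Real.sq_sqrt (by linarith)]
        linarith
      rcases sq_eq_sq_iff_eq_or_eq_neg.1 h' with h | h <;> simp [h]
  have hxconst : ∀ t s, (γ t).1 = (γ s).1 :=
    (continuous_iff_continuousAt.2 fun t => (hx t).continuousAt).eq_of_forall_mem_countable
      (Set.toFinite _).countable hmem
  have hyeq : ∀ t, (γ t).2 - δ * (a2 * (γ t).1 + (γ t).1 ^ 3 / 3) = 0 := fun t =>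
    (hx t).unique <|
      (hasDerivAt_const t _).congr_of_eventuallyEq (.of_forall fun s => hxconst s t)
  intro t s
  refine Prod.ext (hxconst t s) ?_
  rw [sub_eq_zero.1 (hyeq t), sub_eq_zero.1 (hyeq s), hxconst t s]
end
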